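/- For every integer n ≥ 2, the polynomial identity P_n(x) = Σ_{T ∈ T_{n−1}^o} 2^{fr(T) − g(T)} · x^{v(T)} · (1+x)^{g(T)} holds (in particular fr(T) ≥ g(T) for every T ∈ T_{n−1}^o). -/

import Mathlib

open scoped Classical

namespace SymDellac

/-- The polynomials `P n` (for `n ≥ 1`) defined by `P 1 = 1` and
`P (n+1) (x) = ((x+2)(x+1)/2) P n (x+2) - (x(x-1)/2) P n (x)`. -/
noncomputable def P : ℕ → Polynomial ℚ
  | 0 => 1
  | 1 => 1
  | n + 2 =>
      Polynomial.C (1/2 : ℚ) *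
        ((Polynomial.X + 2) * (Polynomial.X + 1) * ((P (n+1)).comp (Polynomial.X + 2))
          - Polynomial.X * (Polynomial.X - 1) * (P (n+1)))

/-- The polynomials `D n` defined by `D 0 = 1` and
`D (n+1) (x) = (x+1)(x+2) D n (x+2) - x(x+1) D n (x)`. -/
noncomputable def D : ℕ → Polynomial ℚ
  | 0 => 1
  | n + 1 =>
      (Polynomial.X + 1) * (Polynomial.X + 2) * ((D n).comp (Polynomial.X + 2))
        - Polynomial.X * (Polynomial.X + 1) * (D n)

/-! ### Even extended Dellac configurations -/

/-- `T` is an even extended Dellac configuration of size `n`. -/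
def IsTne (n : ℕ) (T : Finset (ℕ × ℕ)) : Prop :=
  (∀ p ∈ T, 1 ≤ p.1 ∧ p.1 ≤ n ∧ 1 ≤ p.2 ∧ p.2 ≤ 2*n ∧ p.1 ≤ p.2) ∧
  (∀ i ∈ Finset.Icc 1 (2*n), (T.filter (fun p => p.2 = i)).card = 1) ∧
  (∀ j ∈ Finset.Icc 1 n, (T.filter (fun p => p.1 = j)).card = 2)

/-- The finite set of even extended Dellac configurations of size `n`. -/
noncomputable def TneF (n : ℕ) : Finset (Finset (ℕ × ℕ)) :=
  ((Finset.Icc 1 n ×ˢ Finset.Icc 1 (2*n)).powerset).filter (IsTne n)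

/-- Number of free points of an even extended Dellac configuration. -/
def frE (n : ℕ) (T : Finset (ℕ × ℕ)) : ℕ :=
  (T.filter (fun p => 2*n + 1 ≤ p.2 + p.1)).card

/-- The (unique) point of `T` in row `r` (junk value if there is none). -/
noncomputable def rowPt (T : Finset (ℕ × ℕ)) (r : ℕ) : ℕ × ℕ :=
  if h : ∃ p ∈ T, p.2 = r then h.choose else (0, 0)

/-- `p` is the upper of the two points of its column in `T`. -/
def IsUpper (T : Finset (ℕ × ℕ)) (p : ℕ × ℕ) : Prop :=
  ∃ q ∈ T, q.1 = p.1 ∧ q.2 < p.2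

/-- One step of the path of Definition 1.2 (even case). -/
noncomputable def stepE (n : ℕ) (T : Finset (ℕ × ℕ)) (p : ℕ × ℕ) : ℕ × ℕ :=
  if p.1 = n then p
  else if IsUpper T p then rowPt T (2*n - p.1) else rowPt T p.1

/-- The path `(p_0, p_1, …)` starting at the point of row `i` (even case). -/
noncomputable def pathE (n : ℕ) (T : Finset (ℕ × ℕ)) (i k : ℕ) : ℕ × ℕ :=
  (stepE n T)^[k] (rowPt T i)

/-- The set of points of the subsequence `S_T(i)` of strict column records. -/
noncomputable def recSetE (n : ℕ) (T : Finset (ℕ × ℕ)) (i : ℕ) : Set (ℕ × ℕ) :=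
  {p | ∃ k, pathE n T i k = p ∧ ∀ k' < k, (pathE n T i k').1 < p.1}

/-- `b(T)`: `B(T) = S_T(n)` has `b(T) + 1` elements. -/
noncomputable def bStat (n : ℕ) (T : Finset (ℕ × ℕ)) : ℕ := (recSetE n T n).ncard - 1

/-- `r(T)`: `R(T) = S_T(2n)` has `r(T) + 1` elements. -/
noncomputable def rStat (n : ℕ) (T : Finset (ℕ × ℕ)) : ℕ := (recSetE n T (2*n)).ncard - 1

/-- Row of the upper point of column `c` of `T`. -/
noncomputable def upRow (T : Finset (ℕ × ℕ)) (c : ℕ) : ℕ := sSup {i | (c, i) ∈ T}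

/-- Row of the lower point of column `c` of `T`. -/
noncomputable def lowRow (T : Finset (ℕ × ℕ)) (c : ℕ) : ℕ := sInf {i | (c, i) ∈ T}

/-- One step of the root sequence `I_T(j,i)`, in a tableau with `R` rows. -/
noncomputable def rStep (R j : ℕ) (T : Finset (ℕ × ℕ)) (x : ℕ) : ℕ :=
  if (j ≤ x ∧ x ≤ R - j) ∨ x = R then x
  else if R - j + 1 ≤ x ∧ x ≤ R - 1 then upRow T (R - x)
  else lowRow T x

/-- `root_T(j,i)`: the eventual constant value of the sequence `I_T(j,i)`
(junk value `0` if the sequence is not eventually constant). -/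
noncomputable def rootVal (R j : ℕ) (T : Finset (ℕ × ℕ)) (i : ℕ) : ℕ :=
  if h : ∃ v, ∃ N, ∀ k ≥ N, (rStep R j T)^[k] i = v then h.choose else 0

/-- The set `G(T)` for an even extended Dellac configuration. -/
noncomputable def GsetE (n : ℕ) (T : Finset (ℕ × ℕ)) : Set (ℕ × ℕ) :=
  {p | p ∈ T ∧ 2*n + 1 ≤ p.2 + p.1 ∧
    (∃ q ∈ T, q.1 = p.1 ∧ q ≠ p ∧ q ∈ recSetE n T n) ∧ rootVal (2*n) p.1 T p.2 = p.1}

/-- `g(T) = |G(T)|`. -/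
noncomputable def gStat (n : ℕ) (T : Finset (ℕ × ℕ)) : ℕ := (GsetE n T).ncard

/-- `max(T) = b(T) + r(T) + g(T)`. -/
noncomputable def maxStat (n : ℕ) (T : Finset (ℕ × ℕ)) : ℕ :=
  bStat n T + rStat n T + gStat n T

/-! ### Odd extended Dellac configurations -/

/-- `T` is an odd extended Dellac configuration of size `n`. -/
def IsTno (n : ℕ) (T : Finset (ℕ × ℕ)) : Prop :=
  (∀ p ∈ T, 1 ≤ p.1 ∧ p.1 ≤ n ∧ 1 ≤ p.2 ∧ p.2 ≤ 2*n+1 ∧ p.1 ≤ p.2) ∧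
  (∀ i : ℕ, (T.filter (fun p => p.2 = i)).card ≤ 1) ∧
  (∀ i ∈ Finset.Icc 1 n, (T.filter (fun p => p.2 = i)).card = 1) ∧
  (∀ j ∈ Finset.Icc 1 n, (T.filter (fun p => p.1 = j)).card = 2)

/-- The finite set of odd extended Dellac configurations of size `n`. -/
noncomputable def TnoF (n : ℕ) : Finset (Finset (ℕ × ℕ)) :=
  ((Finset.Icc 1 n ×ˢ Finset.Icc 1 (2*n+1)).powerset).filter (IsTno n)

/-- Number of free points of an odd extended Dellac configuration. -/
def frO (n : ℕ) (T : Finset (ℕ × ℕ)) : ℕ :=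
  (T.filter (fun p => 2*n + 2 ≤ p.2 + p.1)).card

/-- One step of the path (odd case): if the required row is empty, stay put. -/
noncomputable def stepO (n : ℕ) (T : Finset (ℕ × ℕ)) (p : ℕ × ℕ) : ℕ × ℕ :=
  if p.1 = n then p
  else
    let r : ℕ := if IsUpper T p then 2*n + 1 - p.1 else p.1
    if ∃ q ∈ T, q.2 = r then rowPt T r else p

/-- The path `(p_0, p_1, …)` starting at the point of row `i` (odd case). -/
noncomputable def pathO (n : ℕ) (T : Finset (ℕ × ℕ)) (i k : ℕ) : ℕ × ℕ :=
  (stepO n T)^[k] (rowPt T i)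

/-- The set of points of `V(T) = S_T(2n+1)` (empty if row `2n+1` is empty). -/
noncomputable def Vset (n : ℕ) (T : Finset (ℕ × ℕ)) : Set (ℕ × ℕ) :=
  if ∃ p ∈ T, p.2 = 2*n + 1 then
    {p | ∃ k, pathO n T (2*n+1) k = p ∧ ∀ k' < k, (pathO n T (2*n+1) k').1 < p.1}
  else ∅

/-- `v(T)`: the number of elements of `V(T)`. -/
noncomputable def vStat (n : ℕ) (T : Finset (ℕ × ℕ)) : ℕ := (Vset n T).ncard

/-- The set `G(T)` for an odd extended Dellac configuration. -/
noncomputable def GsetO (n : ℕ) (T : Finset (ℕ × ℕ)) : Set (ℕ × ℕ) :=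
  {p | p ∈ T ∧ 2*n + 2 ≤ p.2 + p.1 ∧
    (∃ q ∈ T, q.1 = p.1 ∧ q ≠ p ∧ q ∈ Vset n T) ∧ rootVal (2*n+1) p.1 T p.2 = p.1}

/-- `g(T) = |G(T)|` (odd case). -/
noncomputable def gStatO (n : ℕ) (T : Finset (ℕ × ℕ)) : ℕ := (GsetO n T).ncard

/-! ### Dellac configurations and symmetric Dellac configurations -/

/-- `D` is a Dellac configuration of size `N`. -/
def IsDC (N : ℕ) (D : Finset (ℕ × ℕ)) : Prop :=
  (∀ p ∈ D, 1 ≤ p.1 ∧ p.1 ≤ N ∧ 1 ≤ p.2 ∧ p.2 ≤ 2*N ∧ p.1 ≤ p.2 ∧ p.2 ≤ N + p.1) ∧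
  (∀ i ∈ Finset.Icc 1 (2*N), (D.filter (fun p => p.2 = i)).card = 1) ∧
  (∀ j ∈ Finset.Icc 1 N, (D.filter (fun p => p.1 = j)).card = 2)

/-- `D` is a symmetric Dellac configuration of size `N`. -/
def IsSDC (N : ℕ) (D : Finset (ℕ × ℕ)) : Prop :=
  IsDC N D ∧ ∀ p ∈ D, (N + 1 - p.1, 2*N + 1 - p.2) ∈ D

/-- The finite set of symmetric Dellac configurations of size `N`. -/
noncomputable def SDCF (N : ℕ) : Finset (Finset (ℕ × ℕ)) :=
  ((Finset.Icc 1 N ×ˢ Finset.Icc 1 (2*N)).powerset).filter (IsSDC N)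

/-! ### Surjective pistols -/

/-- `p` encodes a surjective pistol of size `n`: position `k` stands for `k+1 ∈ {1,…,2n}`
and value `p k` stands for `(p k) + 1 ∈ {2,4,…,2n}`. -/
def IsSP (n : ℕ) (p : Fin (2*n) → Fin (2*n)) : Prop :=
  (∀ k, Even ((p k : ℕ) + 1) ∧ (k : ℕ) ≤ (p k : ℕ)) ∧
  (∀ m : Fin (2*n), Even ((m : ℕ) + 1) → ∃ k, p k = m)

/-- The finite set of surjective pistols of size `n`. -/
noncomputable def SPF (n : ℕ) : Finset (Fin (2*n) → Fin (2*n)) :=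
  Finset.univ.filter (IsSP n)

/-- `max(f)`: the number of `j ∈ {1,…,2n-2}` with `f(j) = 2n`. -/
noncomputable def maxP (n : ℕ) (p : Fin (2*n) → Fin (2*n)) : ℕ :=
  (Finset.univ.filter (fun k : Fin (2*n) => (k : ℕ) + 1 ≤ 2*n - 2 ∧ (p k : ℕ) + 1 = 2*n)).card

/-- `fd(f)`: the number of doubled fixed points of `f`. -/
noncomputable def fdP (n : ℕ) (p : Fin (2*n) → Fin (2*n)) : ℕ :=
  (Finset.univ.filter (fun k : Fin (2*n) =>
    (k : ℕ) + 1 ≤ 2*n - 2 ∧ (p k : ℕ) = (k : ℕ) ∧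
      ∃ k' : Fin (2*n), (k' : ℕ) < (k : ℕ) ∧ p k' = p k)).card

end SymDellac
/-! ### More constructions -/

namespace SymDellac

/-- `e_{n,k} = Σ_{T ∈ T_n^e, max(T) = k} 2^{fr(T) - 1 - k}`. -/
noncomputable def eStat (n k : ℕ) : ℕ :=
  ∑ T ∈ (TneF n).filter (fun T => maxStat n T = k), 2 ^ (frE n T - 1 - k)

/-- The configuration `T_{n,max}` with points `(j,j)` and `(j, 2n+1-j)` for `j ∈ [n]`. -/
def Tmax (n : ℕ) : Finset (ℕ × ℕ) :=
  (Finset.Icc 1 n).image (fun j => (j, j)) ∪ (Finset.Icc 1 n).image (fun j => (j, 2*n + 1 - j))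

/-- The index of the (unique) empty row of an odd extended Dellac configuration. -/
noncomputable def emptyRowIdx (n : ℕ) (T : Finset (ℕ × ℕ)) : ℕ :=
  sInf {i | 1 ≤ i ∧ i ≤ 2*n + 1 ∧ ∀ p ∈ T, p.2 ≠ i}

/-- The map `φ : T_n^o → T_n^e` deleting the empty row. -/
noncomputable def phi (n : ℕ) (T : Finset (ℕ × ℕ)) : Finset (ℕ × ℕ) :=
  T.image (fun p => if emptyRowIdx n T < p.2 then (p.1, p.2 - 1) else p)

/-- `Omax(T)`: the set of all points of `B(T)`, `R(T)` and `G(T)`. -/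
noncomputable def OmaxE (n : ℕ) (T : Finset (ℕ × ℕ)) : Set (ℕ × ℕ) :=
  recSetE n T n ∪ recSetE n T (2*n) ∪ GsetE n T

/-- Insertion of a point in the box `(j, r)` of a tableau `U` with `R` rows:
add the point `(j, i₀)` where `i₀` is the (unique) row with no point of `U`
in columns `1,…,j-1` whose root equals `r`. -/
noncomputable def insertPt (R j r : ℕ) (U : Finset (ℕ × ℕ)) : Finset (ℕ × ℕ) :=
  if h : ∃ i0, j ≤ i0 ∧ i0 ≤ R ∧ (∀ p ∈ U, p.2 = i0 → j ≤ p.1) ∧ rootVal R j U i0 = r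
  then insert (j, h.choose) U else U

/-- One step (column `j`) of the construction of `P(T)`. -/
noncomputable def Pstep (n : ℕ) (T : Finset (ℕ × ℕ)) (U : Finset (ℕ × ℕ)) (j : ℕ) :
    Finset (ℕ × ℕ) :=
  let U1 := if ∃ p ∈ T, p.1 = j ∧ p ∈ recSetE n T n ∪ recSetE n T (2*n)
    then insertPt (2*n - 1) j (2*n - 1) U else U
  if ∃ p ∈ T, p.1 = j ∧ p ∈ GsetE n T then insertPt (2*n - 1) j j U1 else U1

/-- The map `P : T_n^e → T_{n-1}^o`. -/
noncomputable def Pmap (n : ℕ) (T : Finset (ℕ × ℕ)) : Finset (ℕ × ℕ) :=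
  (List.range' 1 (n-1)).foldl (Pstep n T)
    ((T.filter (fun p => p ∉ OmaxE n T)).image
      (fun p => (p.1, if p.2 < n then p.2 else p.2 - 1)))

end SymDellac

namespace SymDellac

/-! ### An explicit expansion of `P` -/

/-- Coefficients with `P (m+1) (x) = Σ_e expCoeff m e x`. -/
noncomputable def expCoeff : ℕ → ℕ → ℚ → ℚ
  | 0, e, _ => if e = 0 then 1 else 0
  | m + 1, 0, x => -(1/2) * x * (x - 1) * expCoeff m 0 x
  | m + 1, e + 1, x =>
      1/2 * (x + 2 * e + 2) * (x + 2 * e + 1) * (expCoeff m e x - expCoeff m (e + 1) x)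

lemma expCoeff_eq_zero {m e : ℕ} (h : m < e) (x : ℚ) : expCoeff m e x = 0 := by
  induction m generalizing e with
  | zero => simp [expCoeff]; omega
  | succ m ih =>
    obtain ⟨e, rfl⟩ : ∃ e', e = e' + 1 := ⟨e - 1, by omega⟩
    simp [expCoeff, ih (show m < e by omega), ih (show m < e + 1 by omega)]

lemma expCoeff_succ_succ (m e : ℕ) (x : ℚ) :
    expCoeff (m + 1) (e + 1) x =
      1/2 * (x + 2) * (x + 1) * expCoeff m e (x + 2)
        - 1/2 * x * (x - 1) * expCoeff m (e + 1) x := by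
  induction m generalizing e with
  | zero => rcases e with _ | e <;> simp [expCoeff]
  | succ m ih =>
    have hq := ih e
    have hd (e : ℕ) (x : ℚ) : expCoeff (m + 1) (e + 1) x =
      1/2 * (x + 2 * e + 2) * (x + 2 * e + 1) * (expCoeff m e x - expCoeff m (e + 1) x) := rfl
    have hd0 (x : ℚ) : expCoeff (m + 1) 0 x = -(1/2) * x * (x - 1) * expCoeff m 0 x := rfl
    rw [expCoeff]
    rcases e with _ | e
    · have hd1 := hd 0 x
      push_cast at *
      rw [hd0, hd0]
      linear_combination
        -(1/2 * (x + 2) * (x + 1)) * hq + (1/2 * x * (x - 1)) * hd1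
    · have hp := ih e
      have hd1 := hd (e + 1) x
      have hd2 := hd e (x + 2)
      push_cast at *
      linear_combination (1/2 * (x + 2 * (e + 1) + 2) * (x + 2 * (e + 1) + 1)) * (hp - hq)
        - (1/2 * (x + 2) * (x + 1)) * hd2 + (1/2 * x * (x - 1)) * hd1

lemma sum_expCoeff_succ_mul (m : ℕ) (x : ℚ) (g : ℕ → ℚ) :
    ∑ e ∈ Finset.range (m + 2), expCoeff (m + 1) e x * g e =
      ∑ e ∈ Finset.range (m + 1), expCoeff m e x *
        (1/2 * (x + 2 * e + 2) * (x + 2 * e + 1) * g (e + 1)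
          - 1/2 * (x + 2 * e) * (x + 2 * e - 1) * g e) := by
  have h : ∑ e ∈ Finset.range (m + 1), expCoeff m e x * (1/2 * (x + 2 * e) * (x + 2 * e - 1) * g e)
      = ∑ e ∈ Finset.range (m + 2),
          expCoeff m e x * (1/2 * (x + 2 * e) * (x + 2 * e - 1) * g e) := by
    rw [Finset.sum_range_succ _ (m + 1), expCoeff_eq_zero (Nat.lt_succ_self m)]; simp
  simp_rw [mul_sub (expCoeff m _ x)]
  rw [Finset.sum_sub_distrib, h, Finset.sum_range_succ', Finset.sum_range_succ' _ (m + 1),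
    ← sub_sub, ← Finset.sum_sub_distrib, sub_eq_add_neg]
  congr 1
  · refine Finset.sum_congr rfl fun e _ => ?_
    simp only [expCoeff]; push_cast; ring
  · simp only [expCoeff]; push_cast; ring

lemma eval_P_succ (m : ℕ) (x : ℚ) :
    (P (m + 1)).eval x = ∑ e ∈ Finset.range (m + 1), expCoeff m e x := by
  induction m generalizing x with
  | zero => simp [P, expCoeff]
  | succ m ih =>
    have h : (P (m + 2)).eval x = 1/2 * ((x + 2) * (x + 1) * (P (m + 1)).eval (x + 2)
        - x * (x - 1) * (P (m + 1)).eval x) := by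
      simp [P, Polynomial.eval_comp]
    rw [h, ih, ih, Finset.sum_range_succ' (fun e => expCoeff (m + 1) e x)]
    have h2 : ∑ e ∈ Finset.range (m + 1), expCoeff m e x
        = ∑ e ∈ Finset.range (m + 1), expCoeff m (e + 1) x + expCoeff m 0 x := by
      rw [← Finset.sum_range_succ' (fun e => expCoeff m e x), Finset.sum_range_succ _ (m + 1),
        expCoeff_eq_zero (Nat.lt_succ_self m), add_zero]
    simp_rw [expCoeff_succ_succ]
    rw [Finset.sum_sub_distrib, ← Finset.mul_sum, ← Finset.mul_sum, h2]
    simp only [expCoeff]; ring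

/-! ### A transfer recursion on sets of unused rows -/

/-- The total weight of the choices of `k` free rows. -/
def freeWt (k : ℕ) (y : ℚ) : ℚ :=
  if k = 0 then 1 else if k = 1 then 2 * y else 2 * y * (y - 1)

/-- The weight of completing a partial configuration with `m` columns left, where `A` is the set of
unused rows among the rows `lo, …, lo + 2m - 1` and `y` accounts for the unused free rows. -/
noncomputable def transfer : ℕ → ℕ → Finset ℕ → ℚ → ℚ
  | 0, _, _, _ => 1
  | m + 1, lo, A, y =>
      ∑ s ∈ A.powerset.filter (fun s => s.card ≤ 2 ∧ (lo ∈ A → lo ∈ s)),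
        freeWt (2 - s.card) y * transfer m (lo + 1) ((A \ s).erase (lo + 2 * m + 1))
          (y + (if lo + 2 * m + 1 ∈ A \ s then 1 else 0) - ((2 - s.card : ℕ) : ℚ))

/-- The sum of the weights over all states with `k - 2` used rows. -/
noncomputable def transferSum (m lo k : ℕ) (x : ℚ) : ℚ :=
  ∑ A ∈ (Finset.Ico lo (lo + 2 * m)).powerset.filter (fun A => A.card + k = 2 * m + 2),
    transfer m lo A (x + k - 2)

/-- The number `2 ^ (k - 2) * (N.choose (k - 2))`, read as `0` for `k < 2`. -/
def scaledChoose (N : ℕ) : ℕ → ℚ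
  | 0 => 0
  | 1 => 0
  | k + 2 => 2 ^ k * (N.choose k : ℚ)

lemma succ_mul_choose_succ_cast (N k : ℕ) :
    ((k : ℚ) + 1) * (N.choose (k + 1) : ℚ) = ((N : ℚ) - k) * (N.choose k : ℚ) := by
  rcases le_or_gt k N with h | h
  · have := Nat.choose_succ_right_eq N k
    have h2 : ((N.choose (k + 1) * (k + 1) : ℕ) : ℚ) = ((N.choose k * (N - k) : ℕ) : ℚ) := by
      rw [this]
    push_cast [Nat.cast_sub h] at h2
    linarith
  · rw [Nat.choose_eq_zero_of_lt h, Nat.choose_eq_zero_of_lt (by omega)]; simp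

lemma scaledChoose_recurrence (N k : ℕ) (x : ℚ) :
    ∑ t ∈ Finset.range 3, ((k + t).choose t : ℚ) * freeWt (2 - t) (x + k) *
        (scaledChoose N (k + t) + scaledChoose N (k + t + 1)) =
      1/2 * (x + N + 2) * (x + N + 1) * scaledChoose (N + 2) (k + 2)
        - 1/2 * (x + N) * (x + N - 1) * scaledChoose N (k + 2) := by
  have c2 : ((k + 2).choose 2 : ℚ) = (k + 2) * (k + 1) / 2 := by
    rw [Nat.cast_choose_two]; push_cast; ring
  simp only [Finset.sum_range_succ, Finset.sum_range_zero, zero_add, freeWt]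
  norm_num
  rw [c2]
  rcases k with _ | _ | k
  · simp [scaledChoose]; ring
  · simp only [scaledChoose, Nat.choose_zero_right, Nat.choose_one_right]
    have h := succ_mul_choose_succ_cast N 1
    simp at h
    have h' : (N.choose 2 : ℚ) = (N - 1) * N / 2 := by linarith
    simp only [zero_add, h']
    push_cast
    ring
  · simp only [scaledChoose]
    have e1 := succ_mul_choose_succ_cast N k
    have e2 := succ_mul_choose_succ_cast N (k + 1)
    have e3 := succ_mul_choose_succ_cast N (k + 2)
    rw [show (N + 2).choose (k + 1 + 1) = N.choose k + 2 * N.choose (k + 1) + N.choose (k + 2) by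
      simp only [Nat.choose_succ_succ']; ring]
    push_cast at e1 e2 e3 ⊢
    simp only [pow_succ]
    linear_combination (2:ℚ) ^ k * (4 * (k + 4) * e3 + (8 * x + 4 * N + 6 * k + 18) * e2
      + 2 * (2 * x + N + k + 3) * e1)

lemma sum_powerset_card_le_two {α : Type*} (X : Finset α) (g : ℕ → ℚ) :
    ∑ s ∈ X.powerset.filter (fun s => s.card ≤ 2), g s.card =
      ∑ t ∈ Finset.range 3, (X.card.choose t : ℚ) * g t := by
  rw [Finset.sum_filter, Finset.sum_powerset_apply_card (fun c => if c ≤ 2 then g c else 0)]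
  have h1 : Finset.range (X.card + 1) ⊆ Finset.range (X.card + 4) := by
    intro t; simp only [Finset.mem_range]; omega
  have h2 : Finset.range 3 ⊆ Finset.range (X.card + 4) := by
    intro t; simp only [Finset.mem_range]; omega
  rw [Finset.sum_subset h1, ← Finset.sum_subset h2 (f := fun t => (X.card.choose t) •
    (if t ≤ 2 then g t else 0))]
  · refine Finset.sum_congr rfl fun t ht => ?_
    rw [if_pos (by rw [Finset.mem_range] at ht; omega), nsmul_eq_mul]
  · intro t _ ht
    rw [if_neg (by rw [Finset.mem_range] at ht; omega), smul_zero]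
  · intro t _ ht
    rw [Nat.choose_eq_zero_of_lt (by rw [Finset.mem_range] at ht; omega), zero_smul]

/-- Summing over a set `A` and a subset `s` containing `lo` when `A` does amounts to summing over
`D = A \ s`, which avoids `lo`, and over `s` in the complement of `D`. -/
lemma sum_powerset_sdiff (lo hi N : ℕ) (hlo : lo ≤ hi) (ψ : ℕ → Finset ℕ → ℚ) :
    ∑ A ∈ (Finset.Ico lo (hi + 1)).powerset.filter (fun A => A.card = N),
      ∑ s ∈ A.powerset.filter (fun s => s.card ≤ 2 ∧ (lo ∈ A → lo ∈ s)), ψ s.card (A \ s) =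
    ∑ D ∈ (Finset.Ico (lo + 1) (hi + 1)).powerset,
      ∑ s ∈ (Finset.Ico lo (hi + 1) \ D).powerset.filter (fun s => s.card ≤ 2),
        if D.card + s.card = N then ψ s.card D else 0 := by
  simp_rw [← Finset.sum_filter (fun s : Finset ℕ => _ + s.card = N)]
  rw [Finset.sum_sigma', Finset.sum_sigma']
  refine Finset.sum_nbij' (fun p => ⟨p.1 \ p.2, p.2⟩) (fun p => ⟨p.1 ∪ p.2, p.2⟩) ?_ ?_ ?_ ?_ ?_
  · rintro ⟨A, s⟩ h
    simp only [Finset.mem_sigma, Finset.mem_filter, Finset.mem_powerset] at h ⊢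
    obtain ⟨⟨hA, hc⟩, hs, h2, hl⟩ := h
    refine ⟨?_, ⟨?_, h2⟩, ?_⟩
    · intro a ha
      have h3 := hA (Finset.mem_sdiff.1 ha).1
      have h4 : a ≠ lo := by
        rintro rfl
        exact (Finset.mem_sdiff.1 ha).2 (hl (Finset.mem_sdiff.1 ha).1)
      simp only [Finset.mem_Ico] at h3 ⊢
      omega
    · intro a ha
      simp [ha, hA (hs ha)]
    · rw [Finset.card_sdiff_add_card_eq_card hs, hc]
  · rintro ⟨D, s⟩ h
    simp only [Finset.mem_sigma, Finset.mem_filter, Finset.mem_powerset] at h ⊢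
    obtain ⟨hD, ⟨hs, h2⟩, hc⟩ := h
    refine ⟨⟨?_, ?_⟩, Finset.subset_union_right, h2, ?_⟩
    · refine Finset.union_subset (hD.trans ?_) (hs.trans Finset.sdiff_subset)
      exact Finset.Ico_subset_Ico (by omega) le_rfl
    · rw [Finset.card_union_of_disjoint, hc]
      exact (Finset.disjoint_of_subset_left hs Finset.sdiff_disjoint).symm
    · intro h
      rcases Finset.mem_union.1 h with h | h
      · have := hD h; simp at this
      · exact h
  · rintro ⟨A, s⟩ h
    simp only [Finset.mem_sigma, Finset.mem_filter, Finset.mem_powerset] at h ⊢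
    simp [Finset.union_eq_left.2 h.2.1]
  · rintro ⟨D, s⟩ h
    simp only [Finset.mem_sigma, Finset.mem_filter, Finset.mem_powerset] at h ⊢
    have hd : Disjoint D s :=
      (Finset.disjoint_of_subset_left h.2.1.1 Finset.sdiff_disjoint).symm
    simp [Finset.union_sdiff_right, Finset.sdiff_eq_self_of_disjoint hd]
  · rintro ⟨A, s⟩ h
    rfl

lemma transferSum_succ (m lo k : ℕ) (x : ℚ) :
    transferSum (m + 1) lo (k + 2) x =
      ∑ t ∈ Finset.range 3, ((k + t).choose t : ℚ) * freeWt (2 - t) (x + k) *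
        (transferSum m (lo + 1) (k + t) x + transferSum m (lo + 1) (k + t + 1) x) := by
  set hi := lo + 2 * m + 1 with hhi
  set ψ : ℕ → Finset ℕ → ℚ := fun t D => freeWt (2 - t) (x + k) *
    transfer m (lo + 1) (D.erase hi)
      (x + k + (if hi ∈ D then 1 else 0) - ((2 - t : ℕ) : ℚ)) with hψ
  have h1 : transferSum (m + 1) lo (k + 2) x =
      ∑ A ∈ (Finset.Ico lo (hi + 1)).powerset.filter (fun A => A.card = 2 * m + 2 - k ∧ k ≤ 2 * m + 2),
      ∑ s ∈ A.powerset.filter (fun s => s.card ≤ 2 ∧ (lo ∈ A → lo ∈ s)), ψ s.card (A \ s) := by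
    unfold transferSum
    refine Finset.sum_congr ?_ fun A _ => ?_
    · rw [show lo + 2 * (m + 1) = hi + 1 by omega]
      ext A
      simp only [Finset.mem_filter]
      refine and_congr_right fun _ => ?_
      omega
    · rw [show x + ((k + 2 : ℕ) : ℚ) - 2 = x + k by push_cast; ring]
      rfl
  have h2 : transferSum (m + 1) lo (k + 2) x =
      ∑ D ∈ (Finset.Ico (lo + 1) (hi + 1)).powerset,
        ∑ s ∈ (Finset.Ico lo (hi + 1) \ D).powerset.filter (fun s => s.card ≤ 2),
          if D.card + s.card + k = 2 * m + 2 then ψ s.card D else 0 := by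
    rw [h1]
    by_cases hk : k ≤ 2 * m + 2
    · simp only [hk, and_true]
      rw [sum_powerset_sdiff lo hi _ (by omega)]
      refine Finset.sum_congr rfl fun D _ => Finset.sum_congr rfl fun s _ => ?_
      refine if_congr ?_ rfl rfl
      omega
    · simp only [hk, and_false, Finset.filter_false, Finset.sum_empty]
      refine (Finset.sum_eq_zero fun D _ => Finset.sum_eq_zero fun s _ => if_neg ?_).symm
      omega
  rw [h2]
  have h3 : ∀ D ∈ (Finset.Ico (lo + 1) (hi + 1)).powerset,
      ∑ s ∈ (Finset.Ico lo (hi + 1) \ D).powerset.filter (fun s => s.card ≤ 2),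
          (if D.card + s.card + k = 2 * m + 2 then ψ s.card D else 0) =
        ∑ t ∈ Finset.range 3, ((k + t).choose t : ℚ) *
          (if D.card + t + k = 2 * m + 2 then ψ t D else 0) := by
    intro D hD
    rw [sum_powerset_card_le_two _ (fun t => if D.card + t + k = 2 * m + 2 then ψ t D else 0)]
    refine Finset.sum_congr rfl fun t _ => ?_
    have hsub : D ⊆ Finset.Ico lo (hi + 1) :=
      (Finset.mem_powerset.1 hD).trans (Finset.Ico_subset_Ico (by omega) le_rfl)
    split_ifs with h
    · rw [Finset.card_sdiff_of_subset hsub, Nat.card_Ico,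
        show hi + 1 - lo - D.card = k + t by omega]
    · simp
  rw [Finset.sum_congr rfl h3, Finset.sum_comm]
  refine Finset.sum_congr rfl fun t ht => ?_
  rw [Finset.mem_range] at ht
  rw [← Finset.mul_sum, mul_assoc]
  congr 1
  have hins : Finset.Ico (lo + 1) (hi + 1) = insert hi (Finset.Ico (lo + 1) (lo + 1 + 2 * m)) := by
    ext a; simp only [Finset.mem_Ico, Finset.mem_insert]; omega
  have hni : hi ∉ Finset.Ico (lo + 1) (lo + 1 + 2 * m) := by
    simp only [Finset.mem_Ico]; omega
  have hc : ((2 - t : ℕ) : ℚ) = 2 - t := by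
    rw [Nat.cast_sub (by omega)]; rfl
  rw [hins, Finset.sum_powerset_insert hni, mul_add]
  unfold transferSum
  simp_rw [Finset.mul_sum, Finset.sum_filter]
  congr 1
  · refine Finset.sum_congr rfl fun A hA => ?_
    have hA' : hi ∉ A := fun h => hni (Finset.mem_powerset.1 hA h)
    refine if_congr (by omega) ?_ rfl
    simp only [hψ, hA', Finset.erase_eq_of_notMem hA', if_false, hc]
    congr 2
    push_cast; ring
  · refine Finset.sum_congr rfl fun A hA => ?_
    have hA' : hi ∉ A := fun h => hni (Finset.mem_powerset.1 hA h)
    rw [Finset.card_insert_of_notMem hA']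
    refine if_congr (by omega) ?_ rfl
    simp only [hψ, Finset.mem_insert_self, Finset.erase_insert hA', if_true, hc]
    congr 2
    push_cast; ring

lemma transferSum_eq (m lo k : ℕ) (x : ℚ) :
    transferSum m lo k x =
      ∑ e ∈ Finset.range (m + 1), expCoeff m e x * scaledChoose (2 * e) k := by
  induction m generalizing lo k with
  | zero =>
    rcases k with _ | _ | _ | k <;>
      simp [transferSum, transfer, expCoeff, scaledChoose, Finset.filter_singleton]
  | succ m ih =>
    rcases k with _ | _ | k
    · simp only [scaledChoose, mul_zero, Finset.sum_const_zero]
      refine Finset.sum_eq_zero fun A hA => ?_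
      rw [Finset.mem_filter, Finset.mem_powerset] at hA
      have := Finset.card_le_card hA.1
      rw [Nat.card_Ico] at this
      omega
    · simp only [scaledChoose, mul_zero, Finset.sum_const_zero]
      refine Finset.sum_eq_zero fun A hA => ?_
      rw [Finset.mem_filter, Finset.mem_powerset] at hA
      have := Finset.card_le_card hA.1
      rw [Nat.card_Ico] at this
      omega
    · rw [transferSum_succ, sum_expCoeff_succ_mul]
      simp_rw [ih, ← Finset.sum_add_distrib, Finset.mul_sum]
      rw [Finset.sum_comm]
      refine Finset.sum_congr rfl fun e _ => ?_
      have h := scaledChoose_recurrence (2 * e) k x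
      push_cast at h
      rw [show 2 * (e + 1) = 2 * e + 2 by ring, ← h, Finset.mul_sum]
      refine Finset.sum_congr rfl fun t _ => ?_
      ring

lemma transfer_Ico (m lo : ℕ) (x : ℚ) :
    transfer m lo (Finset.Ico lo (lo + 2 * m)) x = (P (m + 1)).eval x := by
  have h := transferSum_eq m lo 2 x
  rw [eval_P_succ]
  have h2 : ∀ e, scaledChoose e 2 = 1 := fun e => by simp [scaledChoose]
  simp only [h2, mul_one] at h
  rw [← h, transferSum]
  have h3 : (Finset.Ico lo (lo + 2 * m)).powerset.filter (fun A => A.card + 2 = 2 * m + 2) =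
      {Finset.Ico lo (lo + 2 * m)} := by
    ext A
    simp only [Finset.mem_filter, Finset.mem_powerset, Finset.mem_singleton]
    constructor
    · rintro ⟨hs, hc⟩
      exact Finset.eq_of_subset_of_card_le hs (by rw [Nat.card_Ico]; omega)
    · rintro rfl
      refine ⟨le_rfl, ?_⟩
      rw [Nat.card_Ico]; omega
  rw [h3, Finset.sum_singleton]
  congr 1
  push_cast; ring

/-! ### Partial configurations and roots -/

/-- `U` consists of the first `j - 1` columns of an odd extended Dellac configuration of
size `n`. -/
structure IsPartial (n j : ℕ) (U : Finset (ℕ × ℕ)) : Prop where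
  mem : ∀ p ∈ U, 1 ≤ p.1 ∧ p.1 < j ∧ p.1 ≤ p.2 ∧ p.2 ≤ 2 * n + 1
  inj : ∀ p ∈ U, ∀ q ∈ U, p.2 = q.2 → p = q
  col : ∀ c, 1 ≤ c → c < j → (U.filter (fun p => p.1 = c)).card = 2
  full : ∀ i, 1 ≤ i → i < j → i ∈ U.image Prod.snd

lemma isTno_iff_isPartial (n : ℕ) (T : Finset (ℕ × ℕ)) : IsTno n T ↔ IsPartial n (n + 1) T := by
  constructor
  · rintro ⟨h1, h2, h3, h4⟩
    refine ⟨fun p hp => ?_, fun p hp q hq h => ?_, fun c hc hc' => ?_, fun i hi hi' => ?_⟩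
    · have := h1 p hp; omega
    · refine Finset.card_le_one.1 (h2 p.2) p ?_ q ?_ <;> simp [hp, hq, h]
    · exact h4 c (Finset.mem_Icc.2 ⟨hc, by omega⟩)
    · obtain ⟨p, hp⟩ := Finset.card_pos.1 (by rw [h3 i (Finset.mem_Icc.2 ⟨hi, by omega⟩)]; omega)
      rw [Finset.mem_filter] at hp
      exact Finset.mem_image.2 ⟨p, hp⟩
  · rintro ⟨h1, h2, h3, h4⟩
    have h5 : ∀ i, (T.filter (fun p => p.2 = i)).card ≤ 1 := by
      intro i
      refine Finset.card_le_one.2 fun p hp q hq => ?_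
      rw [Finset.mem_filter] at hp hq
      exact h2 p hp.1 q hq.1 (hp.2.trans hq.2.symm)
    refine ⟨fun p hp => ?_, h5, fun i hi => ?_, fun j hj => ?_⟩
    · have := h1 p hp; omega
    · rw [Finset.mem_Icc] at hi
      obtain ⟨p, hp⟩ := Finset.mem_image.1 (h4 i hi.1 (by omega))
      refine le_antisymm (h5 i) (Finset.card_pos.2 ⟨p, Finset.mem_filter.2 hp⟩)
    · rw [Finset.mem_Icc] at hj
      exact h3 j hj.1 (by omega)

lemma mem_TnoF {n : ℕ} {T : Finset (ℕ × ℕ)} : T ∈ TnoF n ↔ IsPartial n (n + 1) T := by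
  rw [← isTno_iff_isPartial, TnoF, Finset.mem_filter, and_iff_right_iff_imp, Finset.mem_powerset]
  intro h p hp
  have := h.1 p hp
  simp only [Finset.mem_product, Finset.mem_Icc]
  omega

lemma IsPartial.filter {n j k : ℕ} {U : Finset (ℕ × ℕ)} (h : IsPartial n k U) (hjk : j ≤ k) :
    IsPartial n j (U.filter (fun p => p.1 < j)) := by
  refine ⟨fun p hp => ?_, fun p hp q hq => ?_, fun c hc hc' => ?_, fun i hi hi' => ?_⟩
  · rw [Finset.mem_filter] at hp
    have := h.mem p hp.1
    omega
  · exact h.inj p (Finset.mem_filter.1 hp).1 q (Finset.mem_filter.1 hq).1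
  · rw [← h.col c hc (by omega), Finset.filter_filter]
    congr 1
    refine Finset.filter_congr fun p _ => ?_
    omega
  · obtain ⟨p, hp, rfl⟩ := Finset.mem_image.1 (h.full i hi (by omega))
    refine Finset.mem_image.2 ⟨p, Finset.mem_filter.2 ⟨hp, ?_⟩, rfl⟩
    have := h.mem p hp
    omega

lemma column_rows {U : Finset (ℕ × ℕ)} {c : ℕ} (h : (U.filter (fun p => p.1 = c)).card = 2) :
    lowRow U c < upRow U c ∧ ∀ i, (c, i) ∈ U ↔ i = lowRow U c ∨ i = upRow U c := by
  obtain ⟨⟨p, a⟩, ⟨q, b⟩, hne, he⟩ := Finset.card_eq_two.1 h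
  have hp : (p, a) ∈ U.filter (fun p => p.1 = c) := by simp [he]
  have hq : (q, b) ∈ U.filter (fun p => p.1 = c) := by simp [he]
  simp only [Finset.mem_filter] at hp hq
  obtain ⟨hp, rfl⟩ := hp
  obtain ⟨hq, rfl⟩ := hq
  have hab : a ≠ b := fun h => hne (by rw [h])
  have hm : ∀ i, (q, i) ∈ U ↔ i = a ∨ i = b := by
    intro i
    have : (q, i) ∈ U.filter (fun p => p.1 = q) ↔ i = a ∨ i = b := by rw [he]; simp
    simpa using this
  have hs : {i | (q, i) ∈ U} = {a, b} := by
    ext i; simp [hm]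
  have hl : lowRow U q = a ⊓ b := by rw [lowRow, hs, csInf_pair]
  have hu : upRow U q = a ⊔ b := by rw [upRow, hs, csSup_pair]
  rw [hl, hu]
  refine ⟨by simpa using hab.symm, fun i => ?_⟩
  rw [hm]
  rcases le_total a b with h | h
  · rw [inf_eq_left.2 h, sup_eq_right.2 h]
  · rw [inf_eq_right.2 h, sup_eq_left.2 h, or_comm]

/-- The boxes in which the points of column `j` may be inserted. -/
def boxes (n j : ℕ) : Finset ℕ := insert (2 * n + 1) (Finset.Ico j (2 * n + 2 - j))

/-- The rows without any point of `U`, among the rows in which column `j` may have a point. -/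
def availRows (n j : ℕ) (U : Finset (ℕ × ℕ)) : Finset ℕ :=
  Finset.Ico j (2 * n + 2) \ U.image Prod.snd

lemma rStep_of_mem_boxes {n j : ℕ} (hj : j ≤ n + 1) {x : ℕ} (hx : x ∈ boxes n j)
    (U : Finset (ℕ × ℕ)) : rStep (2 * n + 1) j U x = x := by
  simp only [boxes, Finset.mem_insert, Finset.mem_Ico] at hx
  rw [rStep, if_pos (by omega)]

lemma rStep_of_notMem_boxes {n j : ℕ} (hj : j ≤ n + 1) {x : ℕ} (hx : 1 ≤ x) (hx' : x ≤ 2 * n + 1)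
    (hb : x ∉ boxes n j) (U : Finset (ℕ × ℕ)) :
    ∃ c, 1 ≤ c ∧ c < j ∧ ((x = 2 * n + 1 - c ∧ rStep (2 * n + 1) j U x = upRow U c) ∨
      (x = c ∧ rStep (2 * n + 1) j U x = lowRow U c)) := by
  simp only [boxes, Finset.mem_insert, Finset.mem_Ico] at hb
  by_cases h : 2 * n + 1 - j + 1 ≤ x ∧ x ≤ 2 * n + 1 - 1
  · refine ⟨2 * n + 1 - x, by omega, by omega, Or.inl ⟨by omega, ?_⟩⟩
    rw [rStep, if_neg (by omega), if_pos h]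
  · refine ⟨x, by omega, by omega, Or.inr ⟨rfl, ?_⟩⟩
    rw [rStep, if_neg (by omega), if_neg h]

lemma rStep_filter {n j : ℕ} {T : Finset (ℕ × ℕ)} (hT : ∀ p ∈ T, p.1 ≤ n) (hj : j ≤ n + 1) :
    rStep (2 * n + 1) j (T.filter (fun p => p.1 < j)) = rStep (2 * n + 1) j T := by
  have h : ∀ c, (c < j ∨ n < c) → ∀ i, ((c, i) ∈ T.filter (fun p => p.1 < j) ↔ (c, i) ∈ T) := by
    intro c hc i
    simp only [Finset.mem_filter, and_iff_left_iff_imp]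
    intro hi
    have := hT _ hi
    simp only at this
    omega
  ext x
  unfold rStep
  split_ifs with h1 h2
  · rfl
  · unfold upRow
    simp_rw [h (2 * n + 1 - x) (by omega)]
  · unfold lowRow
    simp_rw [h x (by omega)]

lemma rootVal_filter {n j : ℕ} {T : Finset (ℕ × ℕ)} (hT : ∀ p ∈ T, p.1 ≤ n) (hj : j ≤ n + 1) :
    rootVal (2 * n + 1) j (T.filter (fun p => p.1 < j)) = rootVal (2 * n + 1) j T := by
  ext i
  unfold rootVal
  rw [rStep_filter hT hj]

lemma rootVal_eq_of_iterate {R j : ℕ} {T : Finset (ℕ × ℕ)} {i v N : ℕ}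
    (h : (rStep R j T)^[N] i = v) (hv : rStep R j T v = v) : rootVal R j T i = v := by
  have h1 : ∀ k ≥ N, (rStep R j T)^[k] i = v := by
    intro k hk
    obtain ⟨d, rfl⟩ := Nat.exists_eq_add_of_le hk
    rw [add_comm, Function.iterate_add_apply, h, Function.iterate_fixed hv]
  have h2 : ∃ v, ∃ N, ∀ k ≥ N, (rStep R j T)^[k] i = v := ⟨v, N, h1⟩
  rw [rootVal, dif_pos h2]
  obtain ⟨M, hM⟩ := h2.choose_spec
  rw [← hM (max M N) (le_max_left _ _), h1 _ (le_max_right _ _)]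

section Iterate

variable {α : Type*} {f : α → α} {X V : Set α}

lemma iterate_inj_of_notMem_image {i i' : α} {N M : ℕ} (hf : ∀ x ∈ X, f x ∈ V)
    (hinj : Set.InjOn f X) (hi : i ∉ V) (hi' : i' ∉ V) (hN : ∀ l < N, f^[l] i ∈ X)
    (hM : ∀ l < M, f^[l] i' ∈ X) (h : f^[N] i = f^[M] i') : N = M ∧ i = i' := by
  induction N generalizing M with
  | zero =>
    rcases M with _ | M
    · exact ⟨rfl, h⟩
    · rw [Function.iterate_succ_apply', Function.iterate_zero_apply] at h
      exact absurd (by simpa [← h] using hf _ (hM M (Nat.lt_succ_self M))) hi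
  | succ N ih =>
    rcases M with _ | M
    · rw [Function.iterate_succ_apply', Function.iterate_zero_apply] at h
      exact absurd (by simpa [h] using hf _ (hN N (Nat.lt_succ_self N))) hi'
    · rw [Function.iterate_succ_apply', Function.iterate_succ_apply'] at h
      have := ih (fun l hl => hN l (by omega)) (fun l hl => hM l (by omega))
        (hinj (hN N (Nat.lt_succ_self N)) (hM M (Nat.lt_succ_self M)) h)
      exact ⟨by omega, this.2⟩

lemma exists_iterate_notMem (hX : X.Finite) {i : α} (hf : ∀ x ∈ X, f x ∈ V)
    (hinj : Set.InjOn f X) (hi : i ∉ V) : ∃ N, f^[N] i ∉ X := by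
  by_contra! h
  refine hX.not_infinite (Set.infinite_of_injective_forall_mem (f := fun N : ℕ => f^[N] i) ?_ h)
  intro N M hNM
  exact (iterate_inj_of_notMem_image hf hinj hi hi (fun l _ => h l) (fun l _ => h l) hNM).1

end Iterate

namespace IsPartial

variable {n j : ℕ} {U : Finset (ℕ × ℕ)}

lemma mem_of_rStep (h : IsPartial n j U) (hj : j ≤ n + 1) {x : ℕ} (hx : 1 ≤ x)
    (hx' : x ≤ 2 * n + 1) (hb : x ∉ boxes n j) :
    ∃ c, 1 ≤ c ∧ c < j ∧ (c, rStep (2 * n + 1) j U x) ∈ U := by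
  obtain ⟨c, hc, hc', hcase⟩ := rStep_of_notMem_boxes hj hx hx' hb U
  have := (column_rows (h.col c hc hc')).2 (rStep (2 * n + 1) j U x)
  exact ⟨c, hc, hc', by rw [this]; tauto⟩

lemma rStep_mem_image (h : IsPartial n j U) (hj : j ≤ n + 1) :
    ∀ x ∈ {x | (1 ≤ x ∧ x ≤ 2 * n + 1) ∧ x ∉ boxes n j},
      rStep (2 * n + 1) j U x ∈ {x | x ∈ U.image Prod.snd} := by
  rintro x ⟨⟨hx, hx'⟩, hb⟩
  obtain ⟨c, -, -, hc⟩ := h.mem_of_rStep hj hx hx' hb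
  exact Finset.mem_image.2 ⟨_, hc, rfl⟩

lemma injOn_rStep (h : IsPartial n j U) (hj : j ≤ n + 1) :
    Set.InjOn (rStep (2 * n + 1) j U) {x | (1 ≤ x ∧ x ≤ 2 * n + 1) ∧ x ∉ boxes n j} := by
  rintro x ⟨⟨hx, hx'⟩, hb⟩ y ⟨⟨hy, hy'⟩, hyb⟩ hxy
  obtain ⟨c, hc, hc', hcase⟩ := rStep_of_notMem_boxes hj hx hx' hb U
  obtain ⟨d, hd, hd', hdase⟩ := rStep_of_notMem_boxes hj hy hy' hyb U
  have h1 := column_rows (h.col c hc hc')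
  have h2 := column_rows (h.col d hd hd')
  have m1 : (c, rStep (2 * n + 1) j U x) ∈ U := by rw [h1.2]; tauto
  have m2 : (d, rStep (2 * n + 1) j U y) ∈ U := by rw [h2.2]; tauto
  have := h.inj _ m1 _ m2 hxy
  simp only [Prod.mk.injEq] at this
  obtain ⟨rfl, -⟩ := this
  have := h1.1
  omega

/-- The root sequence of an available row stays outside of the boxes until it reaches its root. -/
lemma exists_iterate_eq_rootVal (h : IsPartial n j U) (hj : 1 ≤ j) (hjn : j ≤ n + 1) {i : ℕ}
    (hi : i ∈ availRows n j U) :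
    rootVal (2 * n + 1) j U i ∈ boxes n j ∧
    ∃ N, (rStep (2 * n + 1) j U)^[N] i = rootVal (2 * n + 1) j U i ∧
      ∀ l < N, (1 ≤ (rStep (2 * n + 1) j U)^[l] i ∧ (rStep (2 * n + 1) j U)^[l] i ≤ 2 * n + 1) ∧
        (rStep (2 * n + 1) j U)^[l] i ∉ boxes n j := by
  set f := rStep (2 * n + 1) j U
  rw [availRows, Finset.mem_sdiff, Finset.mem_Ico] at hi
  have hfin : {x | (1 ≤ x ∧ x ≤ 2 * n + 1) ∧ x ∉ boxes n j}.Finite :=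
    (Set.finite_Icc 1 (2 * n + 1)).subset fun x hx => hx.1
  have hex := exists_iterate_notMem hfin (h.rStep_mem_image hjn) (h.injOn_rStep hjn)
    (i := i) hi.2
  have hlt : ∀ l < Nat.find hex, (1 ≤ f^[l] i ∧ f^[l] i ≤ 2 * n + 1) ∧ f^[l] i ∉ boxes n j :=
    fun l hl => not_not.1 (Nat.find_min hex hl)
  have hN := Nat.find_spec hex
  set N := Nat.find hex
  have hbd : 1 ≤ f^[N] i ∧ f^[N] i ≤ 2 * n + 1 := by
    rcases hNe : N with _ | M
    · simp only [Function.iterate_zero, id]; omega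
    · rw [Function.iterate_succ_apply']
      have h1 := hlt M (by omega)
      obtain ⟨c, -, -, hc⟩ := h.mem_of_rStep hjn h1.1.1 h1.1.2 h1.2
      have hm : _ ∧ _ ∧ c ≤ f (f^[M] i) ∧ f (f^[M] i) ≤ 2 * n + 1 := h.mem _ hc
      omega
  have hb : f^[N] i ∈ boxes n j := by
    by_contra hb
    exact hN ⟨hbd, hb⟩
  have hr : rootVal (2 * n + 1) j U i = f^[N] i :=
    rootVal_eq_of_iterate rfl (rStep_of_mem_boxes hjn hb U)
  exact ⟨hr ▸ hb, N, hr.symm, hlt⟩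

lemma injOn_rootVal (h : IsPartial n j U) (hj : 1 ≤ j) (hjn : j ≤ n + 1) :
    Set.InjOn (rootVal (2 * n + 1) j U) (availRows n j U) := by
  intro i hi i' hi' hii
  obtain ⟨-, N, hN, hlN⟩ := h.exists_iterate_eq_rootVal hj hjn hi
  obtain ⟨-, M, hM, hlM⟩ := h.exists_iterate_eq_rootVal hj hjn hi'
  refine (iterate_inj_of_notMem_image (h.rStep_mem_image hjn) (h.injOn_rStep hjn)
    ?_ ?_ hlN hlM (by rw [hN, hM, hii])).2
  · exact (Finset.mem_sdiff.1 hi).2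
  · exact (Finset.mem_sdiff.1 hi').2

lemma card_eq (h : IsPartial n j U) : U.card = 2 * (j - 1) := by
  have hm : ∀ p ∈ U, p.1 ∈ Finset.Ico 1 j := by
    intro p hp
    have := h.mem p hp
    rw [Finset.mem_Ico]; omega
  rw [Finset.card_eq_sum_card_fiberwise hm, Finset.sum_congr rfl (g := fun _ => 2)]
  · simp [mul_comm]
  · intro c hc
    rw [Finset.mem_Ico] at hc
    exact h.col c hc.1 hc.2

lemma card_availRows (h : IsPartial n j U) (hj : 1 ≤ j) :
    (availRows n j U).card + 2 * (j - 1) = 2 * n + 1 := by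
  have h1 : availRows n j U = Finset.Ico 1 (2 * n + 2) \ U.image Prod.snd := by
    ext i
    simp only [availRows, Finset.mem_sdiff, Finset.mem_Ico]
    constructor
    · rintro ⟨h1, h2⟩
      exact ⟨by omega, h2⟩
    · rintro ⟨h1, h2⟩
      have := h.full i (by omega)
      refine ⟨⟨?_, h1.2⟩, h2⟩
      by_contra hij
      exact h2 (this (by omega))
  have h2 : U.image Prod.snd ⊆ Finset.Ico 1 (2 * n + 2) := by
    intro i hi
    obtain ⟨p, hp, rfl⟩ := Finset.mem_image.1 hi
    have := h.mem p hp
    rw [Finset.mem_Ico]; omega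
  have h3 : (U.image Prod.snd).card = 2 * (j - 1) := by
    rw [Finset.card_image_of_injOn, h.card_eq]
    intro p hp q hq hpq
    exact h.inj p hp q hq hpq
  have h4 := Finset.card_sdiff_add_card_eq_card h2
  rw [h3, Nat.card_Ico, ← h1] at h4
  omega

lemma exists_rootVal_eq (h : IsPartial n j U) (hj : 1 ≤ j) (hjn : j ≤ n + 1) {b : ℕ}
    (hb : b ∈ boxes n j) : ∃ i ∈ availRows n j U, rootVal (2 * n + 1) j U i = b := by
  have hc : (boxes n j).card ≤ (availRows n j U).card := by
    have := h.card_availRows hj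
    rw [boxes, Finset.card_insert_of_notMem (by rw [Finset.mem_Ico]; omega), Nat.card_Ico]
    omega
  have := Finset.surjOn_of_injOn_of_card_le (rootVal (2 * n + 1) j U)
    (fun i hi => (h.exists_iterate_eq_rootVal hj hjn hi).1) (h.injOn_rootVal hj hjn) hc
  obtain ⟨i, hi, hib⟩ := this hb
  exact ⟨i, hi, hib⟩

end IsPartial

lemma rootVal_of_mem_boxes {n j : ℕ} (hj : j ≤ n + 1) {x : ℕ} (hx : x ∈ boxes n j)
    (U : Finset (ℕ × ℕ)) : rootVal (2 * n + 1) j U x = x :=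
  rootVal_eq_of_iterate (N := 0) rfl (rStep_of_mem_boxes hj hx U)

/-! ### Roots and the path from the top row -/

lemma rowPt_eq {n j : ℕ} {T : Finset (ℕ × ℕ)} (hT : IsPartial n j T) {p : ℕ × ℕ} (hp : p ∈ T) :
    rowPt T p.2 = p := by
  have h : ∃ q ∈ T, q.2 = p.2 := ⟨p, hp, rfl⟩
  rw [rowPt, dif_pos h]
  exact hT.inj _ h.choose_spec.1 _ hp h.choose_spec.2

lemma exists_stepO_eq {n j c r : ℕ} {T : Finset (ℕ × ℕ)} (hT : IsPartial n (n + 1) T)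
    (hp : (c, r) ∈ T) (hcj : c < j) (hj : j ≤ n) :
    ∃ x, (1 ≤ x ∧ x ≤ 2 * n + 1) ∧ x ∉ boxes n j ∧ rStep (2 * n + 1) j T x = r ∧
      stepO n T (c, r) = if ∃ q ∈ T, q.2 = x then rowPt T x else (c, r) := by
  have hm := hT.mem _ hp
  simp only at hm
  have hcol := column_rows (hT.col c hm.1 hm.2.1)
  have hr := (hcol.2 r).1 hp
  refine ⟨if IsUpper T (c, r) then 2 * n + 1 - c else c, ?_, ?_, ?_, ?_⟩
  · split_ifs <;> omega
  · simp only [boxes, Finset.mem_insert, Finset.mem_Ico]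
    split_ifs <;> omega
  · split_ifs with hu
    · rw [rStep, if_neg (by omega), if_pos (by omega),
        show 2 * n + 1 - (2 * n + 1 - c) = c by omega]
      obtain ⟨⟨c', q⟩, hq, hqc, hqr⟩ := hu
      simp only at hqc hqr
      subst hqc
      have := (hcol.2 q).1 hq
      omega
    · rw [rStep, if_neg (by omega), if_neg (by omega)]
      rcases hr with hr | hr
      · exact hr.symm
      · refine absurd ⟨(c, lowRow T c), (hcol.2 _).2 (Or.inl rfl), rfl, ?_⟩ hu
        simp only
        omega
  · rw [stepO, if_neg (by simp only; omega)]

lemma pathO_mem {n : ℕ} {T : Finset (ℕ × ℕ)} (hT : IsPartial n (n + 1) T) {r : ℕ}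
    (hr : ∃ p ∈ T, p.2 = r) (k : ℕ) : pathO n T r k ∈ T := by
  have hrow : ∀ r, (∃ p ∈ T, p.2 = r) → rowPt T r ∈ T := by
    rintro r ⟨p, hp, rfl⟩
    rwa [rowPt_eq hT hp]
  induction k with
  | zero => exact hrow r hr
  | succ k ih =>
    rw [pathO, Function.iterate_succ_apply']
    change stepO n T (pathO n T r k) ∈ T
    rw [stepO]
    dsimp only
    split_ifs with h1 h2 h3 h4
    · exact ih
    · exact hrow _ h3
    · exact ih
    · exact hrow _ h4
    · exact ih

lemma Vset_subset {n : ℕ} {T : Finset (ℕ × ℕ)} (hT : IsPartial n (n + 1) T) :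
    Vset n T ⊆ T := by
  intro p hp
  rw [Vset] at hp
  split_ifs at hp with h
  · obtain ⟨k, rfl, -⟩ := hp
    exact pathO_mem hT h k
  · exact hp.elim

lemma mem_Vset_iff {n : ℕ} {T : Finset (ℕ × ℕ)} (hT : IsPartial n (n + 1) T) {p : ℕ × ℕ}
    (hp : p ∈ T) : p ∈ Vset n T ↔ rootVal (2 * n + 1) p.1 T p.2 = 2 * n + 1 := by
  obtain ⟨j, i⟩ := p
  dsimp only
  have hm := hT.mem _ hp
  simp only at hm
  have hcol : ∀ p ∈ T, p.1 ≤ n := fun p hp => by have := hT.mem p hp; omega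
  have hU := hT.filter (j := j) (by omega)
  have hfU := rStep_filter hcol (j := j) (by omega)
  have hrU := rootVal_filter hcol (j := j) (by omega)
  set U := T.filter (fun p => p.1 < j) with hUdef
  have hav : i ∈ availRows n j U := by
    rw [availRows, Finset.mem_sdiff, Finset.mem_Ico]
    refine ⟨by omega, fun h => ?_⟩
    obtain ⟨q, hq, hqi⟩ := Finset.mem_image.1 h
    rw [hUdef, Finset.mem_filter] at hq
    have := hT.inj _ hq.1 _ hp hqi
    rw [this] at hq
    simp at hq
  have hbox : 2 * n + 1 ∈ boxes n j := Finset.mem_insert_self _ _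
  constructor
  · intro hV
    rw [Vset] at hV
    split_ifs at hV with hex
    swap
    · exact hV.elim
    obtain ⟨k, hk, hlt⟩ := hV
    have hrow : ∀ l < k, rStep (2 * n + 1) j T (pathO n T (2 * n + 1) (l + 1)).2 =
        (pathO n T (2 * n + 1) l).2 := by
      intro l hl
      have hmem : ((pathO n T (2 * n + 1) l).1, (pathO n T (2 * n + 1) l).2) ∈ T :=
        pathO_mem hT hex l
      obtain ⟨x, -, -, hx', hstep'⟩ := exists_stepO_eq hT hmem (hlt l hl) (by omega)
      have hx : rStep (2 * n + 1) j T x = (pathO n T (2 * n + 1) l).2 := hx'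
      have hstep : stepO n T (pathO n T (2 * n + 1) l) =
        if ∃ q ∈ T, q.2 = x then rowPt T x else pathO n T (2 * n + 1) l := hstep'
      have hsucc : ∀ l, pathO n T (2 * n + 1) (l + 1) = stepO n T (pathO n T (2 * n + 1) l) :=
        fun l => Function.iterate_succ_apply' _ _ _
      split_ifs at hstep with hne
      · obtain ⟨q, hq, rfl⟩ := hne
        rw [hsucc, hstep, rowPt_eq hT hq, hx]
      · have hfix : pathO n T (2 * n + 1) k = pathO n T (2 * n + 1) l := by
          obtain ⟨d, rfl⟩ := Nat.exists_eq_add_of_le hl.le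
          rw [pathO, add_comm, Function.iterate_add_apply]
          exact Function.iterate_fixed hstep d
        have := hlt l hl
        rw [← hfix, hk] at this
        simp at this
    have hit : ∀ l ≤ k, (rStep (2 * n + 1) j T)^[l] i = (pathO n T (2 * n + 1) (k - l)).2 := by
      intro l
      induction l with
      | zero => intro _; simp [hk]
      | succ l ih =>
        intro hl
        rw [Function.iterate_succ_apply', ih (by omega), show k - l = k - (l + 1) + 1 by omega,
          hrow _ (by omega)]
    refine rootVal_eq_of_iterate (N := k) ?_ (rStep_of_mem_boxes (by omega) hbox T)
    rw [hit k le_rfl, Nat.sub_self]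
    obtain ⟨q, hq, hq2⟩ := hex
    rw [← hq2]
    exact congrArg Prod.snd (rowPt_eq hT hq)
  · intro hroot
    obtain ⟨-, N, hN, hlt⟩ := hU.exists_iterate_eq_rootVal hm.1 (by omega) hav
    rw [hrU, hroot] at hN
    rw [hfU] at hN hlt
    have hinj := hU.injOn_rStep (by omega)
    rw [hfU] at hinj
    set f := rStep (2 * n + 1) j T
    have hused : ∀ l < N, ∃ c < j, (c, f (f^[l] i)) ∈ T := by
      intro l hl
      obtain ⟨c, -, hc, hcU⟩ := hU.mem_of_rStep (by omega) (hlt l hl).1.1 (hlt l hl).1.2 (hlt l hl).2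
      rw [hfU] at hcU
      exact ⟨c, hc, (Finset.mem_filter.1 hcU).1⟩
    have hne : ∀ l ≤ N, ∃ q ∈ T, q.2 = f^[l] i ∧ (1 ≤ l → q.1 < j) := by
      intro l hl
      rcases l with _ | l
      · exact ⟨_, hp, rfl, by omega⟩
      · obtain ⟨c, hc, hcT⟩ := hused l (by omega)
        exact ⟨_, hcT, by rw [Function.iterate_succ_apply'], fun _ => hc⟩
    have hex : ∃ q ∈ T, q.2 = 2 * n + 1 := by
      obtain ⟨q, hq, hq2, -⟩ := hne N le_rfl
      exact ⟨q, hq, hq2.trans hN⟩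
    have hpath : ∀ l ≤ N, pathO n T (2 * n + 1) l = rowPt T (f^[N - l] i) := by
      intro l
      induction l with
      | zero => intro _; simp [pathO, hN]
      | succ l ih =>
        intro hl
        rw [pathO, Function.iterate_succ_apply']
        change stepO n T (pathO n T (2 * n + 1) l) = _
        obtain ⟨c, hc, hcT⟩ := hused (N - (l + 1)) (by omega)
        rw [ih (by omega), show N - l = N - (l + 1) + 1 by omega, Function.iterate_succ_apply',
          rowPt_eq hT hcT]
        obtain ⟨x, hx1, hx2, hx, hstep⟩ := exists_stepO_eq hT hcT hc (by omega)
        have hl' := hlt (N - (l + 1)) (by omega)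
        have hxe : x = f^[N - (l + 1)] i := hinj ⟨hx1, hx2⟩ hl' hx
        obtain ⟨q, hq, hq2, -⟩ := hne (N - (l + 1)) (by omega)
        rw [hstep, if_pos ⟨q, hq, hq2.trans hxe.symm⟩, hxe]
    rw [Vset, if_pos hex]
    refine ⟨N, ?_, fun k hk => ?_⟩
    · rw [hpath N le_rfl, Nat.sub_self]
      exact rowPt_eq hT hp
    · obtain ⟨q, hq, hq2, hqj⟩ := hne (N - k) (by omega)
      rw [hpath k hk.le, ← hq2, rowPt_eq hT hq]
      exact hqj (by omega)

/-! ### The weight of a column -/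

/-- The rows of the points of column `c`. -/
def colRows (T : Finset (ℕ × ℕ)) (c : ℕ) : Finset ℕ :=
  (T.filter (fun p => p.1 = c)).image Prod.snd

/-- The configuration `U`, with points added in column `j`. -/
def addCol (j : ℕ) (U : Finset (ℕ × ℕ)) (s : Finset ℕ) : Finset (ℕ × ℕ) :=
  U ∪ s.image (fun i => (j, i))

/-- The available rows with box in column `j` that are not free. -/
def midRows (n j : ℕ) (U : Finset (ℕ × ℕ)) : Finset ℕ :=
  Finset.Ico j (2 * n + 2 - j) \ U.image Prod.snd

/-- The available rows with free box in column `j`. -/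
def freeRows (n j : ℕ) (U : Finset (ℕ × ℕ)) : Finset ℕ :=
  Finset.Ico (2 * n + 2 - j) (2 * n + 2) \ U.image Prod.snd

/-- The contribution of the point `(j, i)` when column `j` has its points in rows `s`. -/
noncomputable def pointWt (n : ℕ) (x : ℚ) (j : ℕ) (U : Finset (ℕ × ℕ)) (s : Finset ℕ) (i : ℕ) : ℚ :=
  (if 2 * n + 2 ≤ i + j then
    (if rootVal (2 * n + 1) j U i = j ∧
        ∃ i' ∈ s, i' ≠ i ∧ rootVal (2 * n + 1) j U i' = 2 * n + 1 then 1 + x else 2)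
    else 1) * (if rootVal (2 * n + 1) j U i = 2 * n + 1 then x else 1)

/-- The contribution of column `j` when its points are in rows `s`. -/
noncomputable def colWt (n : ℕ) (x : ℚ) (j : ℕ) (U : Finset (ℕ × ℕ)) (s : Finset ℕ) : ℚ :=
  ∏ i ∈ s, pointWt n x j U s i

lemma mem_colRows {T : Finset (ℕ × ℕ)} {c i : ℕ} : i ∈ colRows T c ↔ (c, i) ∈ T := by
  simp [colRows]

lemma availRows_eq_union {n j : ℕ} (hj : 1 ≤ j) (hjn : j ≤ n) (U : Finset (ℕ × ℕ)) :
    availRows n j U = midRows n j U ∪ freeRows n j U := by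
  rw [availRows, midRows, freeRows, ← Finset.union_sdiff_distrib,
    Finset.Ico_union_Ico_eq_Ico (by omega) (by omega)]

lemma disjoint_midRows_freeRows (n j : ℕ) (U : Finset (ℕ × ℕ)) :
    Disjoint (midRows n j U) (freeRows n j U) :=
  Finset.disjoint_of_subset_left Finset.sdiff_subset
    (Finset.disjoint_of_subset_right Finset.sdiff_subset (Finset.Ico_disjoint_Ico_consecutive _ _ _))

lemma rootVal_of_mem_midRows {n j i : ℕ} {U : Finset (ℕ × ℕ)} (hjn : j ≤ n + 1)
    (hi : i ∈ midRows n j U) : rootVal (2 * n + 1) j U i = i :=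
  rootVal_of_mem_boxes hjn (Finset.mem_insert_of_mem (Finset.mem_sdiff.1 hi).1) U

lemma colWt_union {n j : ℕ} {x : ℚ} {U : Finset (ℕ × ℕ)} (hj : 1 ≤ j) (hjn : j ≤ n)
    {s t : Finset ℕ} (hs : s ⊆ midRows n j U) (ht : t ⊆ freeRows n j U) :
    colWt n x j U (s ∪ t) = colWt n x j U t := by
  have hmid : ∀ i ∈ s, rootVal (2 * n + 1) j U i = i ∧ i + j < 2 * n + 2 := by
    intro i hi
    have := hs hi
    refine ⟨rootVal_of_mem_midRows (by omega) this, ?_⟩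
    rw [midRows, Finset.mem_sdiff, Finset.mem_Ico] at this
    omega
  rw [colWt, Finset.prod_union ((disjoint_midRows_freeRows n j U).mono hs ht),
    Finset.prod_eq_one, one_mul]
  · refine Finset.prod_congr rfl fun i _ => ?_
    have : (∃ i' ∈ s ∪ t, i' ≠ i ∧ rootVal (2 * n + 1) j U i' = 2 * n + 1) ↔
        ∃ i' ∈ t, i' ≠ i ∧ rootVal (2 * n + 1) j U i' = 2 * n + 1 := by
      constructor
      · rintro ⟨i', hi', hne, hr⟩
        rcases Finset.mem_union.1 hi' with hi' | hi'
        · have := hmid i' hi'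
          omega
        · exact ⟨i', hi', hne, hr⟩
      · rintro ⟨i', hi', h⟩
        exact ⟨i', Finset.mem_union_right _ hi', h⟩
    simp only [pointWt, this]
  · intro i hi
    have := hmid i hi
    rw [pointWt, if_neg (by omega), if_neg (by omega), one_mul]

lemma sum_colWt {n j : ℕ} (x : ℚ) {U : Finset (ℕ × ℕ)} (h : IsPartial n j U) (hj : 1 ≤ j)
    (hjn : j ≤ n) {s : Finset ℕ} (hs : s ⊆ midRows n j U) (hcard : s.card ≤ 2)
    (hjs : j ∈ midRows n j U → j ∈ s) :
    ∑ t ∈ (freeRows n j U).powersetCard (2 - s.card), colWt n x j U (s ∪ t) =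
      freeWt (2 - s.card) (x + (freeRows n j U).card - 1) := by
  rw [Finset.sum_congr rfl fun t ht =>
    colWt_union hj hjn hs (Finset.mem_powersetCard.1 ht).1]
  have hav := availRows_eq_union hj hjn U
  have hex : ∀ b ∈ boxes n j, b ∉ midRows n j U →
      ∃ f ∈ freeRows n j U, rootVal (2 * n + 1) j U f = b := by
    intro b hb hbm
    obtain ⟨f, hf, hfb⟩ := h.exists_rootVal_eq hj (by omega) hb
    rw [hav, Finset.mem_union] at hf
    rcases hf with hf | hf
    · rw [rootVal_of_mem_midRows (by omega) hf] at hfb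
      exact absurd (hfb ▸ hf) hbm
    · exact ⟨f, hf, hfb⟩
  have hinj : ∀ f ∈ freeRows n j U, ∀ f' ∈ freeRows n j U,
      rootVal (2 * n + 1) j U f = rootVal (2 * n + 1) j U f' → f = f' := by
    intro f hf f' hf'
    exact h.injOn_rootVal hj (by omega) (by rw [hav]; exact Finset.mem_union_right _ hf)
      (by rw [hav]; exact Finset.mem_union_right _ hf')
  have hfree : ∀ f ∈ freeRows n j U, 2 * n + 2 ≤ f + j := by
    intro f hf
    rw [freeRows, Finset.mem_sdiff, Finset.mem_Ico] at hf
    omega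
  obtain ⟨u, hu, hur⟩ := hex (2 * n + 1) (Finset.mem_insert_self _ _) (by
    simp only [midRows, Finset.mem_sdiff, Finset.mem_Ico]
    omega)
  have hne : ∀ f ∈ (freeRows n j U).erase u, rootVal (2 * n + 1) j U f ≠ 2 * n + 1 := by
    intro f hf hfr
    rw [Finset.mem_erase] at hf
    exact hf.1 (hinj _ hf.2 _ hu (hfr.trans hur.symm))
  have hk : (((freeRows n j U).erase u).card : ℚ) = (freeRows n j U).card - 1 := by
    rw [Finset.card_erase_of_mem hu, Nat.cast_sub (Finset.card_pos.2 ⟨u, hu⟩)]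
    simp
  have hs' : s.card = 0 ∨ s.card = 1 ∨ s.card = 2 := by omega
  rcases hs' with hc | hc | hc
  · rw [hc]
    have hs0 : s = ∅ := Finset.card_eq_zero.1 hc
    obtain ⟨t, ht, htr⟩ := hex j (by simp only [boxes, Finset.mem_insert, Finset.mem_Ico]; omega)
      fun hm => by simpa [hs0] using hjs hm
    have htu : t ∈ (freeRows n j U).erase u :=
      Finset.mem_erase.2 ⟨fun htu => by rw [htu] at htr; omega, ht⟩
    have hFr : freeRows n j U = insert u ((freeRows n j U).erase u) :=
      (Finset.insert_erase hu).symm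
    have hpair : ∀ a ∈ ((freeRows n j U).erase u).powersetCard 2, colWt n x j U a = 4 := by
      intro a ha
      rw [Finset.mem_powersetCard] at ha
      rw [colWt, Finset.prod_congr rfl (g := fun _ => (2 : ℚ)), Finset.prod_const, ha.2]
      · norm_num
      · intro i hi
        rw [pointWt, if_pos (hfree _ (Finset.mem_of_mem_erase (ha.1 hi))), if_neg (hne _ (ha.1 hi)),
          if_neg, mul_one]
        rintro ⟨-, i', hi', -, hr⟩
        exact hne _ (ha.1 hi') hr
    have hsing : ∀ f ∈ (freeRows n j U).erase u,
        colWt n x j U (insert u {f}) = 2 * x * (if f = t then 1 + x else 2) := by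
      intro f hf
      have hfu := Finset.mem_erase.1 hf
      rw [colWt, Finset.prod_insert (by simpa using hfu.1.symm), Finset.prod_singleton, pointWt,
        pointWt, if_pos (hfree _ hu), if_pos (hfree _ hfu.2), if_pos hur, if_neg (hne f hf),
        if_neg (by omega), mul_one]
      congr 1
      refine if_congr ?_ rfl rfl
      constructor
      · rintro ⟨hr, -⟩
        exact hinj _ hfu.2 _ ht (hr.trans htr.symm)
      · rintro rfl
        exact ⟨htr, u, by simp, hfu.1.symm, hur⟩
    have hsum : ∑ f ∈ (freeRows n j U).erase u, 2 * x * (if f = t then 1 + x else 2) =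
        2 * x * (1 + x + 2 * ((freeRows n j U).card - 2)) := by
      rw [← Finset.mul_sum, ← Finset.add_sum_erase _ _ htu, if_pos rfl,
        Finset.sum_congr rfl (g := fun _ => (2 : ℚ))]
      · rw [Finset.sum_const, nsmul_eq_mul, Finset.card_erase_of_mem htu,
          Nat.cast_sub (Finset.card_pos.2 ⟨t, htu⟩), hk]
        push_cast
        ring
      · intro f hf
        rw [if_neg (Finset.ne_of_mem_erase hf)]
    have hsplit : (freeRows n j U).powersetCard 2 = ((freeRows n j U).erase u).powersetCard 2 ∪
        (((freeRows n j U).erase u).powersetCard 1).image (insert u) := by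
      conv_lhs => rw [hFr]
      exact Finset.powersetCard_succ_insert (Finset.notMem_erase _ _) 1
    rw [Nat.sub_zero, hsplit, Finset.sum_union, Finset.sum_congr rfl hpair, Finset.sum_image,
      Finset.powersetCard_one, Finset.sum_map]
    · simp only [Function.Embedding.coeFn_mk]
      rw [Finset.sum_congr rfl hsing, hsum, Finset.sum_const, Finset.card_powersetCard,
        nsmul_eq_mul, Nat.cast_choose_two, hk]
      simp only [freeWt, OfNat.ofNat_ne_zero, OfNat.ofNat_ne_one, if_false]
      ring
    · intro a ha b hb hab
      rw [Finset.mem_coe, Finset.mem_powersetCard] at ha hb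
      have h1 : u ∉ a := fun hm => Finset.notMem_erase u _ (ha.1 hm)
      have h2 : u ∉ b := fun hm => Finset.notMem_erase u _ (hb.1 hm)
      rw [← Finset.erase_insert h1, ← Finset.erase_insert h2, hab]
    · rw [Finset.disjoint_left]
      intro a ha hb
      obtain ⟨b, -, rfl⟩ := Finset.mem_image.1 hb
      exact Finset.notMem_erase u _ ((Finset.mem_powersetCard.1 ha).1 (Finset.mem_insert_self u b))
  · rw [hc, Finset.powersetCard_one, Finset.sum_map]
    have hone : ∀ f ∈ freeRows n j U, colWt n x j U {f} =
        2 * (if rootVal (2 * n + 1) j U f = 2 * n + 1 then x else 1) := by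
      intro f hf
      rw [colWt, Finset.prod_singleton, pointWt, if_pos (hfree f hf), if_neg]
      rintro ⟨-, i', hi', hne, -⟩
      exact hne (Finset.mem_singleton.1 hi')
    simp only [Function.Embedding.coeFn_mk]
    rw [Finset.sum_congr rfl hone, ← Finset.mul_sum, ← Finset.add_sum_erase _ _ hu, if_pos hur,
      Finset.sum_congr rfl fun f hf => if_neg (hne f hf), Finset.sum_const, nsmul_eq_mul, hk]
    rw [freeWt, if_neg (by omega), if_pos rfl]
    ring
  · rw [hc]
    simp [colWt, freeWt]

/-! ### Summation over the configurations -/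

/-- The contribution of the columns `j, …, n`. -/
noncomputable def tailWt (n : ℕ) (x : ℚ) (j : ℕ) (T : Finset (ℕ × ℕ)) : ℚ :=
  ∏ c ∈ Finset.Ico j (n + 1), colWt n x c (T.filter (fun p => p.1 < c)) (colRows T c)

lemma tailWt_eq_mul {n j : ℕ} (hjn : j ≤ n) (x : ℚ) (T : Finset (ℕ × ℕ)) :
    tailWt n x j T =
      colWt n x j (T.filter (fun p => p.1 < j)) (colRows T j) * tailWt n x (j + 1) T :=
  Finset.prod_eq_prod_Ico_succ_bot (by omega) _

lemma filter_lt_eq_and_colRows_eq_iff {j : ℕ} {T U : Finset (ℕ × ℕ)} {s : Finset ℕ}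
    (hU : ∀ p ∈ U, p.1 < j) :
    (T.filter (fun p => p.1 < j) = U ∧ colRows T j = s) ↔
      T.filter (fun p => p.1 < j + 1) = addCol j U s := by
  simp only [Finset.ext_iff, Finset.mem_filter, addCol, Finset.mem_union, Finset.mem_image,
    mem_colRows]
  constructor
  · rintro ⟨h1, h2⟩ ⟨c, i⟩
    rcases lt_trichotomy c j with hc | rfl | hc
    · rw [← h1]
      simp only [Prod.mk.injEq]
      constructor
      · rintro ⟨h, -⟩
        exact Or.inl ⟨h, hc⟩
      · rintro (h | ⟨_, -, h, -⟩)
        · exact ⟨h.1, by omega⟩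
        · omega
    · have : (c, i) ∉ U := fun h => lt_irrefl _ (hU _ h)
      simp [this, ← h2]
    · have : (c, i) ∉ U := fun h => by have := hU _ h; simp only at this; omega
      simp only [this, Prod.mk.injEq, false_or]
      constructor
      · rintro ⟨-, h⟩
        omega
      · rintro ⟨_, -, h, -⟩
        omega
  · intro h
    constructor
    · rintro ⟨c, i⟩
      have := h (c, i)
      constructor
      · rintro ⟨h1, h2⟩
        rcases this.1 ⟨h1, by simp only at h2 ⊢; omega⟩ with h3 | ⟨_, -, h3⟩
        · exact h3
        · simp only [Prod.mk.injEq] at h3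
          simp only at h2
          omega
      · intro hm
        exact ⟨(this.2 (Or.inl hm)).1, hU _ hm⟩
    · intro i
      have := h (j, i)
      constructor
      · intro hm
        rcases this.1 ⟨hm, Nat.lt_succ_self j⟩ with h3 | ⟨_, h4, h3⟩
        · exact absurd (hU _ h3) (lt_irrefl _)
        · simp only [Prod.mk.injEq, true_and] at h3
          exact h3 ▸ h4
      · intro hm
        exact (this.2 (Or.inr ⟨i, hm, rfl⟩)).1

lemma IsPartial.addCol {n j : ℕ} {U : Finset (ℕ × ℕ)} (h : IsPartial n j U) (hj : 1 ≤ j)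
    (hjn : j ≤ n) {s : Finset ℕ} (hs : s ⊆ availRows n j U) (hcard : s.card = 2)
    (hjs : j ∈ midRows n j U → j ∈ s) : IsPartial n (j + 1) (addCol j U s) := by
  have hav : ∀ i ∈ s, j ≤ i ∧ i < 2 * n + 2 ∧ i ∉ U.image Prod.snd := by
    intro i hi
    have := hs hi
    rw [availRows, Finset.mem_sdiff, Finset.mem_Ico] at this
    tauto
  have hmem : ∀ p ∈ SymDellac.addCol j U s, p ∈ U ∨ (p.1 = j ∧ p.2 ∈ s) := by
    intro p hp
    rcases Finset.mem_union.1 hp with hp | hp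
    · exact Or.inl hp
    · obtain ⟨i, hi, rfl⟩ := Finset.mem_image.1 hp
      exact Or.inr ⟨rfl, hi⟩
  refine ⟨fun p hp => ?_, fun p hp q hq hpq => ?_, fun c hc hcj => ?_, fun i hi hij => ?_⟩
  · rcases hmem p hp with hp | ⟨hp1, hp2⟩
    · have := h.mem p hp
      omega
    · have := hav _ hp2
      omega
  · rcases hmem p hp with hp | ⟨hp1, hp2⟩ <;> rcases hmem q hq with hq | ⟨hq1, hq2⟩
    · exact h.inj p hp q hq hpq
    · exact absurd (Finset.mem_image.2 ⟨p, hp, hpq⟩) (hav _ hq2).2.2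
    · exact absurd (Finset.mem_image.2 ⟨q, hq, hpq.symm⟩) (hav _ hp2).2.2
    · exact Prod.ext (hp1.trans hq1.symm) hpq
  · rw [SymDellac.addCol, Finset.filter_union]
    rcases eq_or_ne c j with rfl | hne
    · rw [Finset.filter_false_of_mem fun p hp => by have := h.mem p hp; omega, Finset.empty_union,
        Finset.filter_true_of_mem, Finset.card_image_of_injective, hcard]
      · exact Prod.mk_right_injective c
      · intro p hp
        obtain ⟨i, -, rfl⟩ := Finset.mem_image.1 hp
        rfl
    · rw [Finset.filter_false_of_mem (s := s.image _), Finset.union_empty, h.col c hc (by omega)]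
      intro p hp
      obtain ⟨i, -, rfl⟩ := Finset.mem_image.1 hp
      exact hne.symm
  · rw [SymDellac.addCol, Finset.image_union, Finset.mem_union]
    rcases (show i < j ∨ i = j by omega) with hlt | rfl
    · exact Or.inl (h.full i hi hlt)
    · by_cases hU : i ∈ U.image Prod.snd
      · exact Or.inl hU
      · refine Or.inr (Finset.mem_image.2 ⟨(i, i), Finset.mem_image.2 ⟨i, hjs ?_, rfl⟩, rfl⟩)
        rw [midRows, Finset.mem_sdiff, Finset.mem_Ico]
        exact ⟨by omega, hU⟩

/-- The configurations of size `n` whose first `j - 1` columns are given by `U`. -/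
noncomputable def extensions (n j : ℕ) (U : Finset (ℕ × ℕ)) : Finset (Finset (ℕ × ℕ)) :=
  (TnoF n).filter (fun T => T.filter (fun p => p.1 < j) = U)

lemma colRows_mem {n j : ℕ} {T U : Finset (ℕ × ℕ)} (hj : 1 ≤ j) (hjn : j ≤ n)
    (hT : T ∈ extensions n j U) :
    colRows T j ∈ ((availRows n j U).powersetCard 2).filter
      (fun s => j ∈ midRows n j U → j ∈ s) := by
  obtain ⟨hT', hU⟩ := Finset.mem_filter.1 hT
  replace hT := mem_TnoF.1 hT'
  have hav : ∀ i p, (j, i) ∈ T → p ∈ U → p.2 ≠ i := by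
    rintro i p hi hp rfl
    rw [← hU, Finset.mem_filter] at hp
    have := hT.inj _ hp.1 _ hi rfl
    rw [this] at hp
    exact lt_irrefl _ hp.2
  rw [Finset.mem_filter, Finset.mem_powersetCard]
  refine ⟨⟨fun i hi => ?_, ?_⟩, fun hm => ?_⟩
  · rw [mem_colRows] at hi
    have := hT.mem _ hi
    rw [availRows, Finset.mem_sdiff, Finset.mem_Ico]
    refine ⟨by simp only at this; omega, fun him => ?_⟩
    obtain ⟨p, hp, hpi⟩ := Finset.mem_image.1 him
    exact hav i p hi hp hpi
  · rw [colRows, Finset.card_image_of_injOn, hT.col j hj (by omega)]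
    intro p hp q hq
    exact hT.inj _ (Finset.mem_filter.1 hp).1 _ (Finset.mem_filter.1 hq).1
  · obtain ⟨⟨c, r⟩, hp, hpj⟩ := Finset.mem_image.1 (hT.full j hj (by omega))
    simp only at hpj
    subst hpj
    have hm' := hT.mem _ hp
    simp only at hm'
    rw [mem_colRows]
    rcases hm'.2.2.1.lt_or_eq with hlt | heq
    · rw [midRows, Finset.mem_sdiff] at hm
      refine absurd (Finset.mem_image.2 ⟨(c, r), ?_, rfl⟩) hm.2
      rw [← hU, Finset.mem_filter]
      exact ⟨hp, hlt⟩
    · rwa [heq] at hp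

lemma midRows_addCol {n j : ℕ} {U : Finset (ℕ × ℕ)} (hjn : j ≤ n) {s t : Finset ℕ}
    (ht : t ⊆ freeRows n j U) (hjs : j ∈ midRows n j U → j ∈ s) :
    midRows n (j + 1) (addCol j U (s ∪ t)) = (midRows n j U \ s).erase (2 * n + 1 - j) := by
  have hsnd : (addCol j U (s ∪ t)).image Prod.snd = U.image Prod.snd ∪ (s ∪ t) := by
    rw [addCol, Finset.image_union, Finset.image_image]
    congr 1
    exact Finset.image_id
  ext i
  have h1 : i ∈ t → 2 * n + 2 - j ≤ i := fun hi => by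
    have := ht hi
    rw [freeRows, Finset.mem_sdiff, Finset.mem_Ico] at this
    omega
  simp only [midRows] at hjs ⊢
  rw [hsnd]
  simp only [Finset.mem_sdiff, Finset.mem_erase, Finset.mem_Ico, Finset.mem_union, not_or] at hjs ⊢
  constructor
  · rintro ⟨h2, h3, h4, -⟩
    exact ⟨by omega, ⟨by omega, h3⟩, h4⟩
  · rintro ⟨h2, ⟨h3, h4⟩, h5⟩
    refine ⟨⟨?_, by omega⟩, h4, h5, fun h => by have := h1 h; omega⟩
    by_contra hij
    obtain rfl : i = j := by omega
    exact h5 (hjs ⟨h3, h4⟩)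

lemma card_freeRows_addCol {n j : ℕ} {U : Finset (ℕ × ℕ)} (hj : 1 ≤ j) (hjn : j ≤ n)
    {s t : Finset ℕ} (hs : s ⊆ midRows n j U) (ht : t ⊆ freeRows n j U) :
    ((freeRows n (j + 1) (addCol j U (s ∪ t))).card : ℚ) = (freeRows n j U).card +
      (if 2 * n + 1 - j ∈ midRows n j U \ s then 1 else 0) - t.card := by
  have hsnd : (addCol j U (s ∪ t)).image Prod.snd = U.image Prod.snd ∪ (s ∪ t) := by
    rw [addCol, Finset.image_union, Finset.image_image]
    congr 1
    exact Finset.image_id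
  have heq : freeRows n (j + 1) (addCol j U (s ∪ t)) = (freeRows n j U \ t) ∪
      ({2 * n + 1 - j} : Finset ℕ).filter (· ∈ midRows n j U \ s) := by
    ext i
    have h1 : i ∈ t → 2 * n + 2 - j ≤ i := fun hi => by
      have := ht hi
      rw [freeRows, Finset.mem_sdiff, Finset.mem_Ico] at this
      omega
    have h2 : i ∈ s → i < 2 * n + 2 - j := fun hi => by
      have := hs hi
      rw [midRows, Finset.mem_sdiff, Finset.mem_Ico] at this
      omega
    rw [freeRows, freeRows, midRows, hsnd]
    simp only [Finset.mem_sdiff, Finset.mem_Ico, Finset.mem_union, Finset.mem_filter,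
      Finset.mem_singleton, not_or]
    constructor
    · rintro ⟨h4, h5, h6, h7⟩
      by_cases hi : i = 2 * n + 1 - j
      · exact Or.inr ⟨hi, ⟨by omega, h5⟩, h6⟩
      · exact Or.inl ⟨⟨by omega, h5⟩, h7⟩
    · rintro (⟨⟨h4, h5⟩, h6⟩ | ⟨hi, ⟨h4, h5⟩, h6⟩)
      · exact ⟨by omega, h5, fun h => by have := h2 h; omega, h6⟩
      · exact ⟨by omega, h5, h6, fun h => by have := h1 h; omega⟩
  have hcard := Finset.card_sdiff_add_card_eq_card ht
  have hdis : Disjoint (freeRows n j U \ t)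
      (({2 * n + 1 - j} : Finset ℕ).filter (· ∈ midRows n j U \ s)) := by
    refine Finset.disjoint_of_subset_right (Finset.filter_subset _ _) ?_
    rw [Finset.disjoint_singleton_right, freeRows]
    simp only [Finset.mem_sdiff, Finset.mem_Ico]
    omega
  rw [heq, Finset.card_union_of_disjoint hdis, Nat.cast_add, ← hcard, Finset.filter_singleton,
    Nat.cast_add, apply_ite Finset.card, Finset.card_singleton, Finset.card_empty]
  push_cast
  ring

lemma sum_tailWt {n : ℕ} (x : ℚ) (m : ℕ) : ∀ {j : ℕ} {U : Finset (ℕ × ℕ)}, 1 ≤ j → j + m = n + 1 →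
    IsPartial n j U → ∑ T ∈ extensions n j U, tailWt n x j T =
      transfer m j (midRows n j U) (x + (freeRows n j U).card - 1) := by
  induction m with
  | zero =>
    intro j U hj hjm h
    obtain rfl : j = n + 1 := by omega
    have : extensions n (n + 1) U = {U} := by
      ext T
      rw [extensions, Finset.mem_filter, Finset.mem_singleton, mem_TnoF]
      constructor
      · rintro ⟨hT, rfl⟩
        exact (Finset.filter_true_of_mem fun p hp => (hT.mem p hp).2.1).symm
      · rintro rfl
        exact ⟨h, Finset.filter_true_of_mem fun p hp => (h.mem p hp).2.1⟩
    rw [this, Finset.sum_singleton]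
    simp [tailWt, transfer]
  | succ m ih =>
    intro j U hj hjm h
    have hjn : j ≤ n := by omega
    have hU : ∀ p ∈ U, p.1 < j := fun p hp => (h.mem p hp).2.1
    rw [← Finset.sum_fiberwise_of_maps_to fun T hT => colRows_mem hj hjn hT]
    have hfib : ∀ s ∈ ((availRows n j U).powersetCard 2).filter (fun s => j ∈ midRows n j U → j ∈ s),
        ∑ T ∈ (extensions n j U).filter (fun T => colRows T j = s), tailWt n x j T =
          colWt n x j U s * transfer m (j + 1) (midRows n (j + 1) (addCol j U s))
            (x + (freeRows n (j + 1) (addCol j U s)).card - 1) := by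
      intro s hs
      rw [Finset.mem_filter, Finset.mem_powersetCard] at hs
      rw [← ih (by omega) (by omega) (h.addCol hj hjn hs.1.1 hs.1.2 hs.2), Finset.mul_sum]
      refine Finset.sum_congr ?_ fun T hT => ?_
      · rw [extensions, extensions, Finset.filter_filter]
        exact Finset.filter_congr fun T _ => filter_lt_eq_and_colRows_eq_iff hU
      · obtain ⟨-, hT⟩ := Finset.mem_filter.1 hT
        obtain ⟨h1, h2⟩ := (filter_lt_eq_and_colRows_eq_iff hU).2 hT
        rw [tailWt_eq_mul hjn, h1, h2]
    rw [Finset.sum_congr rfl hfib, transfer]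
    have hinner : ∀ s ∈ (midRows n j U).powerset.filter
        (fun s => s.card ≤ 2 ∧ (j ∈ midRows n j U → j ∈ s)),
        freeWt (2 - s.card) (x + (freeRows n j U).card - 1) *
          transfer m (j + 1) ((midRows n j U \ s).erase (j + 2 * m + 1))
            (x + (freeRows n j U).card - 1 +
              (if j + 2 * m + 1 ∈ midRows n j U \ s then 1 else 0) - ((2 - s.card : ℕ) : ℚ)) =
        ∑ t ∈ (freeRows n j U).powersetCard (2 - s.card),
          colWt n x j U (s ∪ t) * transfer m (j + 1) (midRows n (j + 1) (addCol j U (s ∪ t)))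
            (x + (freeRows n (j + 1) (addCol j U (s ∪ t))).card - 1) := by
      intro s hs
      rw [Finset.mem_filter, Finset.mem_powerset] at hs
      rw [← sum_colWt x h hj hjn hs.1 hs.2.1 hs.2.2, Finset.sum_mul]
      refine Finset.sum_congr rfl fun t ht => ?_
      rw [Finset.mem_powersetCard] at ht
      rw [midRows_addCol hjn ht.1 hs.2.2, card_freeRows_addCol hj hjn hs.1 ht.1, ht.2,
        show j + 2 * m + 1 = 2 * n + 1 - j by omega]
      congr 2
      ring
    rw [Finset.sum_congr rfl hinner, Finset.sum_sigma']
    have hav := availRows_eq_union hj hjn U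
    have hdis := disjoint_midRows_freeRows n j U
    refine Finset.sum_bij' (fun s _ => ⟨s ∩ midRows n j U, s ∩ freeRows n j U⟩)
      (fun p _ => p.1 ∪ p.2) ?_ ?_ ?_ ?_ ?_
    · intro s hs
      rw [Finset.mem_filter, Finset.mem_powersetCard, hav] at hs
      have hc : (s ∩ midRows n j U).card + (s ∩ freeRows n j U).card = 2 := by
        rw [← Finset.card_union_of_disjoint
          (hdis.mono Finset.inter_subset_right Finset.inter_subset_right),
          ← Finset.inter_union_distrib_left, Finset.inter_eq_left.2 hs.1.1, hs.1.2]
      simp only [Finset.mem_sigma, Finset.mem_filter, Finset.mem_powerset, Finset.mem_powersetCard]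
      refine ⟨⟨Finset.inter_subset_right, by omega, fun hm => ?_⟩, Finset.inter_subset_right,
        by omega⟩
      exact Finset.mem_inter.2 ⟨hs.2 hm, hm⟩
    · rintro ⟨s, t⟩ hp
      simp only [Finset.mem_sigma, Finset.mem_filter, Finset.mem_powerset,
        Finset.mem_powersetCard] at hp
      obtain ⟨⟨h1, h2, h3⟩, h4, h5⟩ := hp
      rw [Finset.mem_filter, Finset.mem_powersetCard, hav]
      refine ⟨⟨Finset.union_subset_union h1 h4, ?_⟩, fun hm => Finset.mem_union_left _ (h3 hm)⟩
      rw [Finset.card_union_of_disjoint (hdis.mono h1 h4)]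
      omega
    · intro s hs
      rw [Finset.mem_filter, Finset.mem_powersetCard, hav] at hs
      simp only
      rw [← Finset.inter_union_distrib_left, Finset.inter_eq_left.2 hs.1.1]
    · rintro ⟨s, t⟩ hp
      simp only [Finset.mem_sigma, Finset.mem_filter, Finset.mem_powerset,
        Finset.mem_powersetCard] at hp
      obtain ⟨⟨h1, -, -⟩, h4, -⟩ := hp
      have e1 : (s ∪ t) ∩ midRows n j U = s := by
        rw [Finset.union_inter_distrib_right, Finset.inter_eq_left.2 h1,
          Finset.disjoint_iff_inter_eq_empty.1 (hdis.symm.mono_left h4), Finset.union_empty]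
      have e2 : (s ∪ t) ∩ freeRows n j U = t := by
        rw [Finset.union_inter_distrib_right, Finset.inter_eq_left.2 h4,
          Finset.disjoint_iff_inter_eq_empty.1 (hdis.mono_left h1), Finset.empty_union]
      simp only [e1, e2]
    · intro s hs
      rw [Finset.mem_filter, Finset.mem_powersetCard, hav] at hs
      simp only
      rw [← Finset.inter_union_distrib_left, Finset.inter_eq_left.2 hs.1.1]

lemma sum_tailWt_one (n : ℕ) (x : ℚ) :
    ∑ T ∈ TnoF n, tailWt n x 1 T = (P (n + 1)).eval x := by
  have h : IsPartial n 1 ∅ := by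
    refine ⟨by simp, by simp, fun c hc hc' => ?_, fun i hi hi' => ?_⟩ <;> omega
  have hext : extensions n 1 ∅ = TnoF n := by
    refine Finset.filter_true_of_mem fun T hT => ?_
    rw [mem_TnoF] at hT
    exact Finset.filter_false_of_mem fun p hp => by have := hT.mem p hp; omega
  have hsum := sum_tailWt x n le_rfl (by omega) h
  have hmid : midRows n 1 ∅ = Finset.Ico 1 (1 + 2 * n) := by
    rw [midRows, Finset.image_empty, Finset.sdiff_empty, show 2 * n + 2 - 1 = 1 + 2 * n by omega]
  have hfree : (freeRows n 1 ∅).card = 1 := by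
    rw [freeRows, Finset.image_empty, Finset.sdiff_empty, Nat.card_Ico]
    omega
  rw [hext, hmid, hfree, transfer_Ico] at hsum
  rw [hsum]
  simp

/-! ### The weight of a configuration -/

lemma tailWt_one_eq {n : ℕ} {T : Finset (ℕ × ℕ)} (hT : IsPartial n (n + 1) T) (x : ℚ) :
    gStatO n T ≤ frO n T ∧
    tailWt n x 1 T = 2 ^ (frO n T - gStatO n T) * x ^ vStat n T * (1 + x) ^ gStatO n T := by
  have hV : vStat n T = (T.filter (fun p => p ∈ Vset n T)).card := by
    rw [vStat, ← Set.ncard_coe_finset]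
    congr 1
    ext p
    simp only [Finset.coe_filter, Set.mem_ofPred_eq, iff_and_self]
    exact fun hp => Vset_subset hT hp
  set F := T.filter (fun p => 2 * n + 2 ≤ p.2 + p.1) with hF
  set G := F.filter (fun p => p ∈ GsetO n T) with hG
  have hg : gStatO n T = G.card := by
    rw [gStatO, ← Set.ncard_coe_finset]
    congr 1
    ext p
    simp only [hG, hF, Finset.coe_filter, Set.mem_ofPred_eq, Finset.mem_filter, iff_and_self]
    exact fun hp => ⟨hp.1, hp.2.1⟩
  have hf : frO n T = F.card := rfl
  have hGF : G ⊆ F := Finset.filter_subset _ _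
  refine ⟨by rw [hg, hf]; exact Finset.card_le_card hGF, ?_⟩
  have hle : ∀ p ∈ T, p.1 ≤ n := fun p hp => by have := hT.mem p hp; omega
  have hpt : ∀ c ∈ Finset.Ico 1 (n + 1),
      colWt n x c (T.filter (fun p => p.1 < c)) (colRows T c) =
        ∏ p ∈ T.filter (fun p => p.1 = c),
          (if 2 * n + 2 ≤ p.2 + p.1 then (if p ∈ GsetO n T then 1 + x else 2) else 1) *
            (if p ∈ Vset n T then x else 1) := by
    intro c hc
    rw [Finset.mem_Ico] at hc
    rw [colWt, colRows, Finset.prod_image]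
    · refine Finset.prod_congr rfl fun p hp => ?_
      obtain ⟨hpT, rfl⟩ := Finset.mem_filter.1 hp
      rw [pointWt, rootVal_filter hle (by omega)]
      congr 1
      · refine ite_congr rfl (fun hfree => if_congr ?_ rfl rfl) fun _ => rfl
        rw [GsetO, Set.mem_ofPred_eq]
        constructor
        · rintro ⟨h1, i, hi, hne, hr⟩
          have hi' : (p.1, i) ∈ T := mem_colRows.1 hi
          refine ⟨hpT, hfree, ⟨(p.1, i), hi', rfl, fun h => hne (congrArg Prod.snd h), ?_⟩, h1⟩
          exact (mem_Vset_iff hT hi').2 hr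
        · rintro ⟨-, -, ⟨q, hq, hq1, hne, hqV⟩, h1⟩
          have hr := (mem_Vset_iff hT hq).1 hqV
          rw [hq1] at hr
          refine ⟨h1, q.2, ?_, fun h => hne (Prod.ext hq1 h), hr⟩
          exact Finset.mem_image.2 ⟨q, Finset.mem_filter.2 ⟨hq, hq1⟩, rfl⟩
      · exact if_congr (mem_Vset_iff hT hpT).symm rfl rfl
    · intro p hp q hq
      exact hT.inj _ (Finset.mem_filter.1 hp).1 _ (Finset.mem_filter.1 hq).1
  rw [tailWt, Finset.prod_congr rfl hpt, Finset.prod_fiberwise_of_maps_to, Finset.prod_mul_distrib,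
    ← Finset.prod_filter, ← hF, Finset.prod_ite, ← hG, Finset.prod_ite, Finset.prod_const,
    Finset.prod_const, Finset.prod_const, Finset.prod_const_one, ← hV, ← hg, mul_one, hf]
  · have : (F.filter (fun p => ¬ p ∈ GsetO n T)).card = F.card - gStatO n T := by
      rw [hg, hG]
      have := Finset.card_filter_add_card_filter_not (s := F) (fun p => p ∈ GsetO n T)
      omega
    rw [this]
    ring
  · intro p hp
    have := hT.mem p hp
    rw [Finset.mem_Ico]
    omega

/-- **Theorem 1.15.** For all `n ≥ 2`,
`P_n(x) = Σ_{T ∈ T_{n-1}^o} 2^{fr(T) - g(T)} x^{v(T)} (1+x)^{g(T)}`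
(in particular `fr(T) ≥ g(T)` for every `T ∈ T_{n-1}^o`). -/
theorem statement1 (n : ℕ) (hn : 2 ≤ n) :
    (∀ T ∈ TnoF (n-1), gStatO (n-1) T ≤ frO (n-1) T) ∧
    P n = ∑ T ∈ TnoF (n-1),
      Polynomial.C ((2 : ℚ) ^ (frO (n-1) T - gStatO (n-1) T)) *
        Polynomial.X ^ (vStat (n-1) T) * (1 + Polynomial.X) ^ (gStatO (n-1) T) := by
  obtain ⟨m, rfl⟩ : ∃ m, n = m + 1 := ⟨n - 1, by omega⟩
  rw [Nat.add_sub_cancel]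
  refine ⟨fun T hT => (tailWt_one_eq (mem_TnoF.1 hT) 0).1, Polynomial.funext fun x => ?_⟩
  rw [← sum_tailWt_one, Polynomial.eval_finsetSum]
  refine Finset.sum_congr rfl fun T hT => ?_
  rw [(tailWt_one_eq (mem_TnoF.1 hT) x).2]
  simp

end SymDellac
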